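/- arXiv:1904.02482 — 4 statements merged into one kernel-verified Lean document; each statement's English description precedes it below -/
import Mathlib

section
/- Let G be the complete graph on n vertices, and let a, b, m, Δ be non-negative integers with b − Δ ≥ a ≥ 2 and n > (a+b)(a+b+2m−2)/(a+Δ). Let g, f be integer-valued functions on V(G) with a ≤ g(x) ≤ f(x) − Δ ≤ b − Δ for every vertex x. Then G is a fractional (g,f,m)-deleted graph. -/
open Classical Finset

/-- The fractional degree `d_G^h(x)` of a vertex: the sum of `h e` over all edges
(unordered pairs) containing `x`. -/
noncomputable def fracDeg {V : Type*} [Fintype V] [DecidableEq V]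
    (h : Sym2 V → ℝ) (x : V) : ℝ :=
  ∑ e ∈ Finset.univ.filter (fun e : Sym2 V => x ∈ e), h e

/-- `G` admits a fractional `(g,f)`-factor: a weighting `h : E(G) → [0,1]`
(extended by `0` off the edge set) with `g x ≤ d_G^h(x) ≤ f x` for every vertex. -/
def HasFracFactor {V : Type*} [Fintype V] [DecidableEq V]
    (G : SimpleGraph V) (g f : V → ℤ) : Prop :=
  ∃ h : Sym2 V → ℝ,
    (∀ e, 0 ≤ h e ∧ h e ≤ 1) ∧
    (∀ e, e ∉ G.edgeSet → h e = 0) ∧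
    (∀ x : V, (g x : ℝ) ≤ fracDeg h x ∧ fracDeg h x ≤ (f x : ℝ))

/-- `G` is a fractional `(g,f,m)`-deleted graph: after deleting any `m` edges,
the resulting graph admits a fractional `(g,f)`-factor. -/
def FracDeleted {V : Type*} [Fintype V] [DecidableEq V]
    (G : SimpleGraph V) (g f : V → ℤ) (m : ℕ) : Prop :=
  ∀ H : Finset (Sym2 V), ↑H ⊆ G.edgeSet → H.card = m →
    HasFracFactor (G.deleteEdges ↑H) g f

/-- `G` is a fractional `(g,f,n',m)`-critical deleted graph: after deleting any `n'`
vertices, the resulting induced graph is a fractional `(g,f,m)`-deleted graph. -/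
def FracCriticalDeleted {V : Type*} [Fintype V] [DecidableEq V]
    (G : SimpleGraph V) (g f : V → ℤ) (n' m : ℕ) : Prop :=
  ∀ U : Finset V, U.card = n' →
    FracDeleted (G.induce ((↑U : Set V)ᶜ)) (fun x => g x.1) (fun x => f x.1) m

/-- `G` is a fractional ID-`(g,f,m)`-deleted graph: after deleting any independent set
of vertices, the resulting induced graph is a fractional `(g,f,m)`-deleted graph. -/
def FracIDDeleted {V : Type*} [Fintype V] [DecidableEq V]
    (G : SimpleGraph V) (g f : V → ℤ) (m : ℕ) : Prop :=
  ∀ I : Set V, (∀ u ∈ I, ∀ v ∈ I, ¬ G.Adj u v) →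
    FracDeleted (G.induce Iᶜ) (fun x => g x.1) (fun x => f x.1) m

open MeasureTheory

section FractionalFactor

variable {V : Type*} [Fintype V] [DecidableEq V]

lemma fracDeg_eq_sum_mk (h : Sym2 V → ℝ) (x : V) :
    fracDeg h x = ∑ v, h s(x, v) := by
  unfold fracDeg
  symm
  refine Finset.sum_bij (fun v _ => s(x, v)) ?_ ?_ ?_ ?_
  · intro v _
    simp
  · intro v _ w _ hvw
    exact Sym2.congr_right.1 hvw
  · intro e he
    obtain ⟨v, rfl⟩ := (Finset.mem_filter.1 he).2
    exact ⟨v, Finset.mem_univ _, rfl⟩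
  · intro v _
    rfl

lemma max_pos_add_max_pos (p q : ℝ) :
    max 0 (p - max 0 (-q)) + max 0 (q - max 0 (-p)) = if 0 < p + q then p + q else 0 := by
  grind

/-- Layer-cake form of the factor criterion: the integer condition on pairs of disjoint vertex
sets implies the corresponding inequality for every real potential `y`. -/
lemma sum_potential_le {A : V → V → Prop} {g f : V → ℤ}
    (hST : ∀ S T : Finset V, Disjoint S T → (∑ x ∈ T, (g x : ℝ)) ≤ (∑ x ∈ S, (f x : ℝ)) +
      ∑ x ∈ T, (#{v | A x v ∧ v ∉ S} : ℝ)) (y : V → ℝ) :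
    ∑ x, (g x : ℝ) * max 0 (y x) ≤ ∑ x, (f x : ℝ) * max 0 (-y x) +
      ∑ x, ∑ v, if A x v then max 0 (y x - max 0 (-y v)) else 0 := by
  have hind : ∀ p q : ℝ,
      Integrable ((Set.Ioc p q).indicator (fun _ => (1 : ℝ))) ∧
      ∫ θ, (Set.Ioc p q).indicator (fun _ => (1 : ℝ)) θ = max 0 (q - p) := by
    intro p q
    constructor
    · exact (integrable_indicator_iff measurableSet_Ioc).2 (by simp)
    · rw [integral_indicator measurableSet_Ioc]
      simp [Measure.real, ENNReal.toReal_ofReal', max_comm]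
  have hg : ∀ x, (g x : ℝ) * max 0 (y x) =
      ∫ θ, (g x : ℝ) * (Set.Ioc 0 (y x)).indicator (fun _ => (1 : ℝ)) θ := by
    intro x
    rw [integral_const_mul, (hind 0 (y x)).2, sub_zero]
  have hf : ∀ x, (f x : ℝ) * max 0 (-y x) =
      ∫ θ, (f x : ℝ) * (Set.Ioc 0 (-y x)).indicator (fun _ => (1 : ℝ)) θ := by
    intro x
    rw [integral_const_mul, (hind 0 (-y x)).2, sub_zero]
  have hA : ∀ x v, (if A x v then max 0 (y x - max 0 (-y v)) else 0) =
      ∫ θ, (if A x v then (1 : ℝ) else 0) *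
        (Set.Ioc (max 0 (-y v)) (y x)).indicator (fun _ => (1 : ℝ)) θ := by
    intro x v
    rw [integral_const_mul, (hind _ _).2]
    simp
  have ig : ∀ x, Integrable
      (fun θ => (g x : ℝ) * (Set.Ioc 0 (y x)).indicator (fun _ => (1 : ℝ)) θ) :=
    fun x => (hind 0 (y x)).1.const_mul _
  have iF : ∀ x, Integrable
      (fun θ => (f x : ℝ) * (Set.Ioc 0 (-y x)).indicator (fun _ => (1 : ℝ)) θ) :=
    fun x => (hind 0 (-y x)).1.const_mul _
  have iA : ∀ x v, Integrable (fun θ => (if A x v then (1 : ℝ) else 0) *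
      (Set.Ioc (max 0 (-y v)) (y x)).indicator (fun _ => (1 : ℝ)) θ) :=
    fun x v => (hind _ _).1.const_mul _
  simp_rw [hg, hf, hA]
  have iA' : ∀ x, Integrable (fun θ => ∑ v, (if A x v then (1 : ℝ) else 0) *
      (Set.Ioc (max 0 (-y v)) (y x)).indicator (fun _ => (1 : ℝ)) θ) :=
    fun x => integrable_finsetSum _ fun v _ => iA x v
  have hAA : ∀ x, (∑ v, ∫ θ, (if A x v then (1 : ℝ) else 0) *
      (Set.Ioc (max 0 (-y v)) (y x)).indicator (fun _ => (1 : ℝ)) θ) =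
      ∫ θ, ∑ v, (if A x v then (1 : ℝ) else 0) *
      (Set.Ioc (max 0 (-y v)) (y x)).indicator (fun _ => (1 : ℝ)) θ :=
    fun x => (integral_finsetSum _ fun v _ => iA x v).symm
  simp_rw [hAA]
  rw [← integral_finsetSum _ fun x _ => ig x, ← integral_finsetSum _ fun x _ => iF x,
    ← integral_finsetSum _ fun x _ => iA' x,
    ← integral_add (integrable_finsetSum _ fun x _ => iF x)
      (integrable_finsetSum _ fun x _ => iA' x)]
  refine integral_mono (integrable_finsetSum _ fun x _ => ig x)
    ((integrable_finsetSum _ fun x _ => iF x).add (integrable_finsetSum _ fun x _ => iA' x)) ?_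
  intro θ
  simp only
  rcases le_or_gt θ 0 with hθ | hθ
  · have h0 : ∀ p q : ℝ, 0 ≤ p → (Set.Ioc p q).indicator (fun _ => (1 : ℝ)) θ = 0 := by
      intro p q hp
      exact Set.indicator_of_notMem (fun h => absurd h.1 (by linarith)) _
    simp [h0]
  · have key := hST {x | θ ≤ -y x} {x | θ ≤ y x} (by
      rw [Finset.disjoint_left]
      intro x hx hx'
      simp only [Finset.mem_filter, Finset.mem_univ, true_and] at hx hx'
      linarith)
    rw [Finset.sum_filter, Finset.sum_filter, Finset.sum_filter] at key
    refine le_of_eq_of_le ?_ (le_of_le_of_eq key ?_)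
    · refine Finset.sum_congr rfl fun x _ => ?_
      simp [Set.indicator_apply, hθ]
    · congr 1
      · refine Finset.sum_congr rfl fun x _ => ?_
        simp [Set.indicator_apply, hθ]
      · refine Finset.sum_congr rfl fun x _ => ?_
        by_cases hx : θ ≤ y x
        · rw [if_pos hx, Finset.card_filter]
          push_cast
          refine Finset.sum_congr rfl fun v _ => ?_
          by_cases hA' : A x v <;> simp [Set.indicator_apply, hθ, hx, hA']
        · simp [hx]

/-- The sufficient direction of Anstee's criterion for fractional `(g,f)`-factors. -/
lemma hasFracFactor_of_forall_disjoint (G : SimpleGraph V) {g f : V → ℤ}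
    (hgf : ∀ x, g x ≤ f x)
    (hST : ∀ S T : Finset V, Disjoint S T → (∑ x ∈ T, (g x : ℝ)) ≤ (∑ x ∈ S, (f x : ℝ)) +
      ∑ x ∈ T, (#{v | G.Adj x v ∧ v ∉ S} : ℝ)) :
    HasFracFactor G g f := by
  by_contra hno
  let u : Sym2 V → ℝ := fun e => if e ∈ G.edgeSet then 1 else 0
  let L : (Sym2 V → ℝ) →ₗ[ℝ] (V → ℝ) :=
    { toFun := fun h x => fracDeg h x
      map_add' := fun h k => by
        ext x
        simp [fracDeg, Finset.sum_add_distrib]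
      map_smul' := fun c h => by
        ext x
        simp [fracDeg, Finset.mul_sum] }
  let K : Set (V → ℝ) := L '' Set.Icc 0 u
  let B : Set (V → ℝ) := Set.Icc (fun x => (g x : ℝ)) (fun x => (f x : ℝ))
  have hK : IsCompact K := isCompact_Icc.image L.continuous_of_finiteDimensional
  have hKc : Convex ℝ K := (convex_Icc 0 u).linear_image L
  have hdisj : Disjoint K B := by
    rw [Set.disjoint_left]
    rintro _ ⟨h, hh, rfl⟩ hB
    refine hno ⟨h, fun e => ⟨hh.1 e, (hh.2 e).trans ?_⟩, fun e he => ?_,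
      fun x => ⟨hB.1 x, hB.2 x⟩⟩
    · simp only [u]
      split_ifs <;> norm_num
    · have h1 := hh.1 e
      have h2 := hh.2 e
      simp only [u, if_neg he, Pi.zero_apply] at h1 h2
      exact le_antisymm h2 h1
  obtain ⟨F, p, q, hFK, hpq, hFB⟩ :=
    geometric_hahn_banach_compact_closed hKc hK (convex_Icc _ _) isClosed_Icc hdisj
  let y : V → ℝ := fun x => F (Pi.single x 1)
  have hF : ∀ z, F z = ∑ x, z x * y x := by
    intro z
    conv_lhs => rw [pi_eq_sum_univ' z]
    simp [y, map_sum]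
  let h : Sym2 V → ℝ :=
    Sym2.lift ⟨fun x v => if G.Adj x v ∧ 0 < y x + y v then 1 else 0, fun x v => by
      simp only [G.adj_comm x v, add_comm (y x)]⟩
  have hh : ∀ x v, h s(x, v) = if G.Adj x v ∧ 0 < y x + y v then 1 else 0 := fun x v => rfl
  have hmem : L h ∈ K := by
    refine ⟨h, ⟨fun e => ?_, fun e => ?_⟩, rfl⟩
    · induction e with
      | _ x v =>
        rw [hh, Pi.zero_apply]
        split_ifs <;> norm_num
    · induction e with
      | _ x v =>
        simp only [hh, u, SimpleGraph.mem_edgeSet]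
        split_ifs <;> simp_all
  let z : V → ℝ := fun x => if 0 < y x then (g x : ℝ) else f x
  have hz : z ∈ B := by
    constructor <;> intro x <;> have : (g x : ℝ) ≤ f x := by exact_mod_cast hgf x
    all_goals
      simp only [z]
      split_ifs <;> linarith
  have hlt := ((hFK _ hmem).trans hpq).trans (hFB _ hz)
  have hFz : F z = ∑ x, (g x : ℝ) * max 0 (y x) - ∑ x, (f x : ℝ) * max 0 (-y x) := by
    rw [hF, ← Finset.sum_sub_distrib]
    refine Finset.sum_congr rfl fun x _ => ?_
    simp only [z]
    split_ifs with hx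
    · rw [max_eq_right hx.le, max_eq_left (by linarith)]
      ring
    · rw [max_eq_left (by linarith), max_eq_right (by linarith)]
      ring
  have hFh : F (L h) = ∑ x, ∑ v, if G.Adj x v then max 0 (y x - max 0 (-y v)) else 0 := by
    have e1 : F (L h) = ∑ x, ∑ v, h s(x, v) * y x := by
      rw [hF]
      refine Finset.sum_congr rfl fun x _ => ?_
      rw [← Finset.sum_mul, ← fracDeg_eq_sum_mk]
      rfl
    have e2 : F (L h) = ∑ x, ∑ v, h s(x, v) * y v := by
      rw [e1, Finset.sum_comm]
      simp only [Sym2.eq_swap]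
    have e3 : (∑ x, ∑ v, if G.Adj x v then max 0 (y x - max 0 (-y v)) else 0) =
        ∑ x, ∑ v, if G.Adj x v then max 0 (y v - max 0 (-y x)) else 0 := by
      rw [Finset.sum_comm]
      simp only [G.adj_comm]
    have e4 : (∑ x, ∑ v, h s(x, v) * y x) + ∑ x, ∑ v, h s(x, v) * y v =
        (∑ x, ∑ v, if G.Adj x v then max 0 (y x - max 0 (-y v)) else 0) +
        ∑ x, ∑ v, if G.Adj x v then max 0 (y v - max 0 (-y x)) else 0 := by
      simp only [← Finset.sum_add_distrib]
      refine Finset.sum_congr rfl fun x _ => Finset.sum_congr rfl fun v _ => ?_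
      rw [hh]
      by_cases hA : G.Adj x v
      · simp only [hA, true_and, if_true]
        have hpos := max_pos_add_max_pos (y x) (y v)
        split_ifs at hpos ⊢ <;> linarith
      · simp [hA]
    linarith
  have := sum_potential_le hST y
  linarith

lemma sum_card_filter_mk_mem_le (H : Finset (Sym2 V)) (T : Finset V) :
    ∑ x ∈ T, #{v | s(x, v) ∈ H} ≤ 2 * #H := by
  calc ∑ x ∈ T, #{v | s(x, v) ∈ H}
      ≤ ∑ x, #{v | s(x, v) ∈ H} :=
        Finset.sum_le_sum_of_subset (Finset.subset_univ T)
    _ = #{p : V × V | s(p.1, p.2) ∈ H} := by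
        simp only [Finset.card_filter, Fintype.sum_prod_type]
    _ ≤ 2 * #H := by
        refine Finset.card_le_mul_card_image_of_maps_to (f := fun p : V × V => s(p.1, p.2))
          (fun p hp => by simpa using hp) 2 fun e _ => ?_
        induction e with
        | _ x v =>
          refine (Finset.card_le_card (t := {(x, v), (v, x)}) ?_).trans Finset.card_le_two
          rintro ⟨a, b⟩ hp
          simpa using (Finset.mem_filter.1 hp).2

lemma le_sum_card_adj_notMem (G : SimpleGraph V) (H : Finset (Sym2 V)) (S T : Finset V)
    (hG : ∀ x v, x ≠ v → s(x, v) ∉ H → G.Adj x v) :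
    (#T : ℝ) * (Fintype.card V - 1 - #S) - 2 * #H ≤
      ∑ x ∈ T, (#{v | G.Adj x v ∧ v ∉ S} : ℝ) := by
  have h1 : ∀ x ∈ T, (Fintype.card V - 1 - #S : ℝ) ≤
      (#{v | G.Adj x v ∧ v ∉ S} : ℝ) +
      #{v | s(x, v) ∈ H} := by
    intro x _
    have hcov : (Finset.univ : Finset V) ⊆
        (({v | G.Adj x v ∧ v ∉ S} : Finset V) ∪
        ({v | s(x, v) ∈ H} : Finset V)) ∪ (S ∪ {x}) := by
      intro v _
      have := hG x v
      simp only [Finset.mem_union, Finset.mem_filter, Finset.mem_univ, true_and,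
        Finset.mem_singleton]
      grind
    have hc := (Finset.card_le_card hcov).trans ((Finset.card_union_le _ _).trans
      (add_le_add (Finset.card_union_le _ _) (Finset.card_union_le _ _)))
    rw [Finset.card_univ, Finset.card_singleton] at hc
    have : (Fintype.card V : ℝ) ≤ _ := Nat.cast_le.2 hc
    push_cast at this
    linarith
  have h2 := Finset.sum_le_sum h1
  rw [Finset.sum_const, nsmul_eq_mul, Finset.sum_add_distrib] at h2
  have h3 : (∑ x ∈ T, (#{v | s(x, v) ∈ H} : ℝ)) ≤ 2 * #H := by
    exact_mod_cast sum_card_filter_mk_mem_le H T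
  linarith

end FractionalFactor

lemma factor_count_nonneg {n s t D c m : ℝ} (hD : 2 ≤ D) (hc : 4 ≤ c) (hm : 0 ≤ m)
    (hs : 0 ≤ s) (ht : 1 ≤ t) (hst : s + t ≤ n) (hn : c * (c + 2 * m - 2) < D * n)
    (hn' : c + 2 * m - 1 ≤ n) :
    (c - D) * t ≤ D * s + (t * (n - 1 - s) - 2 * m) := by
  rcases le_total D t with h | h
  · nlinarith [mul_nonneg (sub_nonneg.2 h) (sub_nonneg.2 hst), sq_nonneg (t - (c + 1) / 2),
      mul_nonneg hm (by linarith : (0 : ℝ) ≤ c - 1), mul_nonneg (sub_nonneg.2 hc) (sub_nonneg.2 hc)]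
  · nlinarith [mul_nonneg (sub_nonneg.2 h) hs,
      mul_nonneg (sub_nonneg.2 ht) (by linarith : (0 : ℝ) ≤ n - 1 - c + D)]

theorem statement_8 {V : Type*} [Fintype V] [DecidableEq V]
    (a b m Δ : ℕ) (g f : V → ℤ)
    (hba : a + Δ ≤ b) (ha : 2 ≤ a)
    (hn : (Fintype.card V : ℝ) >
      ((a : ℝ) + b) * ((a : ℝ) + b + 2 * m - 2) / ((a : ℝ) + Δ))
    (hgf : ∀ x : V, (a : ℤ) ≤ g x ∧ g x ≤ f x - (Δ : ℤ) ∧ f x - (Δ : ℤ) ≤ (b : ℤ) - (Δ : ℤ)) :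
    FracDeleted (⊤ : SimpleGraph V) g f m := by
  intro H _ hH
  refine hasFracFactor_of_forall_disjoint _ (fun x => by have := hgf x; omega) fun S T hST => ?_
  have hcount := le_sum_card_adj_notMem ((⊤ : SimpleGraph V).deleteEdges ↑H) H S T
    fun x v hxv hH => by simp [hxv, hH]
  rw [hH] at hcount
  have hba' : (a : ℝ) + Δ ≤ b := by exact_mod_cast hba
  have ha' : (2 : ℝ) ≤ a := by exact_mod_cast ha
  have hΔ : (0 : ℝ) ≤ Δ := Nat.cast_nonneg _
  have hm : (0 : ℝ) ≤ m := Nat.cast_nonneg _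
  have hn2 : ((a : ℝ) + b) * (a + b + 2 * m - 2) < (a + Δ) * Fintype.card V := by
    rw [gt_iff_lt, div_lt_iff₀ (by linarith)] at hn
    linarith
  have hn3 : (a : ℝ) + b + 2 * m - 1 ≤ Fintype.card V := by
    have hlt : (a : ℝ) + b + 2 * m - 2 < Fintype.card V := by
      nlinarith [mul_nonneg (by linarith : (0 : ℝ) ≤ b - Δ)
        (by linarith : (0 : ℝ) ≤ a + b + 2 * m - 2)]
    have hlt' : a + b + 2 * m < Fintype.card V + 2 := by
      have : (a : ℝ) + b + 2 * m < Fintype.card V + 2 := by linarith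
      exact_mod_cast this
    have : (a : ℝ) + b + 2 * m + 1 ≤ Fintype.card V + 2 := by exact_mod_cast hlt'
    linarith
  have hfS : ((a : ℝ) + Δ) * #S ≤ ∑ x ∈ S, (f x : ℝ) := by
    rw [mul_comm, ← nsmul_eq_mul]
    refine Finset.card_nsmul_le_sum _ _ _ fun x _ => ?_
    have : (a : ℤ) + Δ ≤ f x := by have := hgf x; omega
    exact_mod_cast this
  have hgT : ∑ x ∈ T, (g x : ℝ) ≤ ((b : ℝ) - Δ) * #T := by
    rw [mul_comm, ← nsmul_eq_mul]
    refine Finset.sum_le_card_nsmul _ _ _ fun x _ => ?_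
    have : g x ≤ (b : ℤ) - Δ := by have := hgf x; omega
    exact_mod_cast this
  rcases T.eq_empty_or_nonempty with rfl | hT
  · have : (0 : ℝ) ≤ (a + Δ) * #S := by positivity
    simp only [Finset.sum_empty, add_zero]
    linarith
  · have ht : (1 : ℝ) ≤ #T := by exact_mod_cast hT.card_pos
    have hst : (#S : ℝ) + #T ≤ Fintype.card V := by
      rw [← Nat.cast_add, ← Finset.card_union_of_disjoint hST]
      exact_mod_cast Finset.card_le_univ _
    have := factor_count_nonneg (D := a + Δ) (c := a + b) (by linarith) (by linarith)
      hm (Nat.cast_nonneg _) ht hst hn2 hn3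
    nlinarith
end

section
/- Let G be the complete graph on n vertices, and let a, b, n', m, Δ be non-negative integers with b − Δ ≥ a ≥ 2 and n > (a+b)(a+b+2m−2)/(a+Δ) + n'. Then G is a fractional (a,b,n',m)-critical deleted graph. -/
open Classical Finset

/-- The fractional degree as a sum over the other endpoint. -/
lemma fracDeg_eq_sum {X : Type*} [Fintype X] [DecidableEq X] (h : Sym2 X → ℝ) (x : X) :
    fracDeg h x = ∑ y, h s(x, y) := by
  unfold fracDeg
  symm
  refine Finset.sum_bij (fun y _ => s(x, y)) ?_ ?_ ?_ ?_
  · intro y _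
    simp
  · intro y _ z _ hyz
    exact Sym2.congr_right.mp hyz
  · intro e he
    obtain ⟨y, rfl⟩ := Sym2.mem_iff_exists.mp (Finset.mem_filter.mp he).2
    exact ⟨y, Finset.mem_univ _, rfl⟩
  · intro y _
    rfl

/-- A weighting of the complement of `D` whose vertex sums turn out to be those of the complete
graph: the weight lost at a vertex of positive `D`-degree is spread over the edges joining it to the
`k` isolated vertices of `D`, and the excess there is taken off the edges between isolated
vertices. -/
noncomputable def balancedWeight {X : Type*} [Fintype X] (D : SimpleGraph X) (k c : ℝ)
    (x y : X) : ℝ :=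
  if x = y ∨ D.Adj x y then 0
  else if D.degree x = 0 ∧ D.degree y = 0 then 1 - c
  else if D.degree x = 0 ∨ D.degree y = 0 then 1 + ((D.degree x : ℝ) + D.degree y) / k
  else 1

lemma balancedWeight_comm {X : Type*} [Fintype X] (D : SimpleGraph X) (k c : ℝ) (x y : X) :
    balancedWeight D k c x y = balancedWeight D k c y x := by
  unfold balancedWeight
  simp only [eq_comm (a := x), D.adj_comm x, and_comm (a := D.degree x = 0),
    or_comm (a := D.degree x = 0), add_comm (D.degree x : ℝ)]

lemma not_adj_of_degree_eq_zero {X : Type*} [Fintype X] {D : SimpleGraph X} {x y : X}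
    (hx : D.degree x = 0) : ¬ D.Adj x y := fun h =>
  absurd hx (D.degree_pos_iff_exists_adj x |>.mpr ⟨y, h⟩).ne'

lemma sum_balancedWeight_of_degree_eq_zero {X : Type*} [Fintype X] (D : SimpleGraph X) {k c : ℝ}
    (hk : k = #{y | D.degree y = 0}) (hc : (k - 1) * c = (∑ y, (D.degree y : ℝ)) / k)
    {x : X} (hx : D.degree x = 0) :
    ∑ y, balancedWeight D k c x y = Fintype.card X - 1 := by
  have key : ∀ y, balancedWeight D k c x y =
      1 + (D.degree y : ℝ) / k - (if D.degree y = 0 then c else 0)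
        - (if x = y then 1 - c else 0) := by
    intro y
    have := not_adj_of_degree_eq_zero (y := y) hx
    by_cases hxy : x = y
    · subst hxy
      simp [balancedWeight, hx]
    · by_cases hy : D.degree y = 0 <;> simp [balancedWeight, hx, hy, hxy, this]
  have hsum : ∑ y, (if D.degree y = 0 then c else 0) = k * c := by
    rw [hk, ← Finset.sum_filter, Finset.sum_const, nsmul_eq_mul]
  simp only [key, Finset.sum_sub_distrib, Finset.sum_add_distrib, ← Finset.sum_div, hsum,
    Finset.sum_ite_eq, Finset.mem_univ, if_true, ← hc, Finset.sum_const, nsmul_eq_mul,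
    Finset.card_univ]
  ring

lemma sum_balancedWeight_of_degree_ne_zero {X : Type*} [Fintype X] (D : SimpleGraph X) {k c : ℝ}
    (hk : k = #{y | D.degree y = 0}) (hk0 : k ≠ 0) {x : X} (hx : D.degree x ≠ 0) :
    ∑ y, balancedWeight D k c x y = Fintype.card X - 1 := by
  have key : ∀ y, balancedWeight D k c x y =
      1 + (if D.degree y = 0 then (D.degree x : ℝ) / k else 0)
        - (if D.Adj x y then 1 else 0) - (if x = y then 1 else 0) := by
    intro y
    by_cases hxy : x = y
    · subst hxy
      simp [balancedWeight, hx]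
    · by_cases hy : D.degree y = 0
      · have : ¬ D.Adj x y := fun h => not_adj_of_degree_eq_zero hy h.symm
        simp [balancedWeight, hx, hy, hxy, this]
      · by_cases h : D.Adj x y <;> simp [balancedWeight, hx, hy, hxy, h]
  have hdeg : ∑ y, (if D.Adj x y then (1 : ℝ) else 0) = D.degree x := by
    rw [Finset.sum_boole, ← SimpleGraph.card_neighborFinset_eq_degree,
      SimpleGraph.neighborFinset_eq_filter]
  have hsum : ∑ y, (if D.degree y = 0 then (D.degree x : ℝ) / k else 0) = D.degree x := by
    rw [← Finset.sum_filter, Finset.sum_const, nsmul_eq_mul, ← mul_div_cancel₀ (D.degree x : ℝ) hk0,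
      hk]
    field_simp
  simp only [key, Finset.sum_sub_distrib, Finset.sum_add_distrib, hdeg, hsum,
    Finset.sum_ite_eq, Finset.mem_univ, if_true, Finset.sum_const, nsmul_eq_mul,
    Finset.card_univ]
  ring

lemma two_mul_le_mul_sub_one {a b m N k : ℝ} (ha : 2 ≤ a) (hab : a ≤ b) (hm : 0 ≤ m)
    (hcard : (a + b) * (a + b + 2 * m - 2) < b * N) (hN : N ≤ k + 2 * m) (hk : a + b ≤ k + 1) :
    2 * m ≤ k * (k - 1) := by
  have h1 : b * N ≤ b * (k + 2 * m) := mul_le_mul_of_nonneg_left hN (by linarith)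
  have h2 : a * (2 * m) ≤ b * k := by nlinarith
  have h3 : b * k ≤ (k - 1) * k := mul_le_mul_of_nonneg_right (by linarith) (by linarith)
  nlinarith

/-- If `D` has enough isolated vertices, its complement has a fractional `a`-factor. -/
lemma hasFracFactor_compl {X : Type*} [Fintype X] [DecidableEq X] {a b k : ℕ} {d : ℝ}
    (hab : a ≤ b) (D : SimpleGraph X) (hd : ∑ x, (D.degree x : ℝ) = d)
    (hk : (k : ℝ) = #{y | D.degree y = 0}) (hk1 : (1 : ℝ) < k)
    (hN1 : (1 : ℝ) < Fintype.card X) (hdk : d ≤ k * (k - 1))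
    (hda : a * d ≤ k * (Fintype.card X - 1 - a)) :
    HasFracFactor Dᶜ (fun _ => (a : ℤ)) (fun _ => (b : ℤ)) := by
  have hd0 : 0 ≤ d := hd ▸ Finset.sum_nonneg fun x _ => Nat.cast_nonneg _
  have hk0 : (0 : ℝ) < k := by linarith
  obtain ⟨c, hc⟩ : ∃ c : ℝ, c = d / (k * (k - 1)) := ⟨_, rfl⟩
  have hc0 : 0 ≤ c := hc ▸ div_nonneg hd0 (hd0.trans hdk)
  have hc1 : c ≤ 1 := hc ▸ div_le_one_of_le₀ hdk (hd0.trans hdk)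
  have hcsum : ((k : ℝ) - 1) * c = (∑ y, (D.degree y : ℝ)) / k := by
    have : (k : ℝ) - 1 ≠ 0 := by linarith
    rw [hd, hc]
    field_simp
  have hq : 0 ≤ d / k := div_nonneg hd0 hk0.le
  obtain ⟨w, hw⟩ : ∃ w : ℝ, w = a / (Fintype.card X - 1) := ⟨_, rfl⟩
  have hw0 : 0 ≤ w := hw ▸ div_nonneg (Nat.cast_nonneg a) (by linarith)
  have hw1 : w * (1 + d / k) ≤ 1 := by
    rw [hw, div_mul_eq_mul_div, div_le_one (by linarith), one_add_div hk0.ne', mul_div_assoc',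
      div_le_iff₀ hk0]
    linarith
  have hbound : ∀ x y, 0 ≤ balancedWeight D k c x y ∧ balancedWeight D k c x y ≤ 1 + d / k := by
    intro x y
    unfold balancedWeight
    split_ifs with h1 h2 h3
    · constructor <;> linarith
    · constructor <;> linarith
    · refine ⟨by positivity, ?_⟩
      gcongr
      rw [← hd]
      exact Finset.add_le_sum (f := fun z => (D.degree z : ℝ)) (fun z _ => Nat.cast_nonneg _)
        (Finset.mem_univ x) (Finset.mem_univ y) fun h => h1 (Or.inl h)
    · constructor <;> linarith
  refine ⟨Sym2.lift ⟨fun x y => w * balancedWeight D k c x y, fun x y =>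
    congrArg (w * ·) (balancedWeight_comm D k c x y)⟩, ?_, ?_, ?_⟩
  · intro e
    induction e with | _ x y =>
    obtain ⟨h0, h1⟩ := hbound x y
    exact ⟨mul_nonneg hw0 h0, (mul_le_mul_of_nonneg_left h1 hw0).trans hw1⟩
  · intro e he
    induction e with | _ x y =>
    have : x = y ∨ D.Adj x y := by
      rw [SimpleGraph.mem_edgeSet, SimpleGraph.compl_adj] at he
      tauto
    simp [balancedWeight, this]
  · intro x
    have hdeg : ∑ y, balancedWeight D k c x y = Fintype.card X - 1 := by
      by_cases hx : D.degree x = 0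
      · exact sum_balancedWeight_of_degree_eq_zero D hk hcsum hx
      · exact sum_balancedWeight_of_degree_ne_zero D hk hk0.ne' hx
    have hfrac : fracDeg (Sym2.lift ⟨fun x y => w * balancedWeight D k c x y, fun x y =>
        congrArg (w * ·) (balancedWeight_comm D k c x y)⟩) x = a := by
      have hne : (Fintype.card X : ℝ) - 1 ≠ 0 := by linarith
      rw [fracDeg_eq_sum]
      simp only [Sym2.lift_mk]
      rw [← Finset.mul_sum, hdeg, hw, div_mul_cancel₀ _ hne]
    rw [hfrac, Int.cast_natCast, Int.cast_natCast]
    exact ⟨le_rfl, Nat.cast_le.mpr hab⟩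

lemma top_deleteEdges_eq_compl {X : Type*} (s : Set (Sym2 X)) :
    (⊤ : SimpleGraph X).deleteEdges s = (SimpleGraph.fromEdgeSet s)ᶜ := by
  ext x y
  simp only [SimpleGraph.deleteEdges_adj, SimpleGraph.top_adj, SimpleGraph.compl_adj,
    SimpleGraph.fromEdgeSet_adj]
  tauto

lemma sum_degree_of_eq_fromEdgeSet {X : Type*} [Fintype X] {D : SimpleGraph X}
    {H : Finset (Sym2 X)} (hD : D = SimpleGraph.fromEdgeSet ↑H)
    (hH : ↑H ⊆ (⊤ : SimpleGraph X).edgeSet) :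
    ∑ x, D.degree x = 2 * #H := by
  have hedges : D.edgeFinset = H := by
    ext e
    induction e with | _ x y =>
    rw [SimpleGraph.mem_edgeFinset, SimpleGraph.mem_edgeSet, hD, SimpleGraph.fromEdgeSet_adj]
    exact ⟨fun h => h.1, fun h => ⟨h, by simpa using hH h⟩⟩
  rw [← hedges]
  convert D.sum_degrees_eq_twice_card_edges

lemma card_le_card_degree_eq_zero_add_sum_degree {X : Type*} [Fintype X] (D : SimpleGraph X) :
    Fintype.card X ≤ #{y | D.degree y = 0} + ∑ x, D.degree x := by
  have h1 := Finset.card_filter_add_card_filter_not (s := (univ : Finset X))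
    (fun y => D.degree y = 0)
  have h2 : #{y | ¬ D.degree y = 0} ≤ ∑ x, D.degree x := by
    rw [Finset.card_filter]
    refine Finset.sum_le_sum fun y _ => ?_
    split_ifs <;> omega
  rw [Finset.card_univ] at h1
  omega

/-- A sufficiently large complete graph with `m` edges deleted has a fractional `[a,b]`-factor. -/
lemma hasFracFactor_top_deleteEdges {X : Type*} [Fintype X] [DecidableEq X] {a b m : ℕ}
    (ha : 2 ≤ a) (hab : a ≤ b)
    (hcard : ((a : ℝ) + b) * (a + b + 2 * m - 2) < b * Fintype.card X)
    (H : Finset (Sym2 X)) (hH : ↑H ⊆ (⊤ : SimpleGraph X).edgeSet) (hm : #H = m) :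
    HasFracFactor ((⊤ : SimpleGraph X).deleteEdges ↑H) (fun _ => (a : ℤ)) (fun _ => (b : ℤ)) := by
  rw [top_deleteEdges_eq_compl]
  obtain ⟨D, hD⟩ : ∃ D : SimpleGraph X, D = SimpleGraph.fromEdgeSet ↑H := ⟨_, rfl⟩
  rw [← hD]
  have hsum := sum_degree_of_eq_fromEdgeSet hD hH
  have hle := card_le_card_degree_eq_zero_add_sum_degree D
  rw [hm] at hsum
  rw [hsum] at hle
  obtain ⟨k, hk⟩ : ∃ k : ℕ, k = #{y | D.degree y = 0} := ⟨_, rfl⟩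
  rw [← hk] at hle
  have haR : (2 : ℝ) ≤ a := by exact_mod_cast ha
  have habR : (a : ℝ) ≤ b := by exact_mod_cast hab
  have hmR : (0 : ℝ) ≤ m := Nat.cast_nonneg m
  have hN : a + b + 2 * m ≤ Fintype.card X + 1 := by
    have hNlt : (a : ℝ) + b + 2 * m < Fintype.card X + 2 := by nlinarith
    have : a + b + 2 * m < Fintype.card X + 2 := by exact_mod_cast hNlt
    omega
  have hNR : (a : ℝ) + b + 2 * m ≤ Fintype.card X + 1 := by exact_mod_cast hN
  have hkab : (a : ℝ) + b ≤ k + 1 := by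
    have : a + b ≤ k + 1 := by omega
    exact_mod_cast this
  have hleR : (Fintype.card X : ℝ) ≤ k + 2 * m := by exact_mod_cast hle
  refine hasFracFactor_compl (d := 2 * m) hab _ (by exact_mod_cast hsum) (by rw [hk])
    (by linarith) (by linarith) (two_mul_le_mul_sub_one haR habR hmR hcard hleR hkab) ?_
  apply mul_le_mul <;> linarith

theorem statement_9 {V : Type*} [Fintype V] [DecidableEq V]
    (a b n' m Δ : ℕ)
    (hba : a + Δ ≤ b) (ha : 2 ≤ a)
    (hn : (Fintype.card V : ℝ) >
      ((a : ℝ) + b) * ((a : ℝ) + b + 2 * m - 2) / ((a : ℝ) + Δ) + n') :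
    FracCriticalDeleted (⊤ : SimpleGraph V) (fun _ => (a : ℤ)) (fun _ => (b : ℤ)) n' m := by
  intro U hU H hH hm
  have hcard : Fintype.card V = Fintype.card ↥((↑U : Set V)ᶜ) + n' := by
    have h1 := Finset.card_le_univ U
    have h2 : Fintype.card ↥((↑U : Set V)ᶜ) = Fintype.card V - #U := by
      rw [← Nat.card_eq_fintype_card, Nat.card_coe_set_eq, Set.ncard_compl,
        Set.ncard_coe_finset, Nat.card_eq_fintype_card]
    omega
  rw [SimpleGraph.induce_top] at hH ⊢
  refine hasFracFactor_top_deleteEdges ha (by omega) ?_ H hH hm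
  rw [hcard] at hn
  push_cast at hn
  have haR : (2 : ℝ) ≤ a := by exact_mod_cast ha
  have hbaR : (a : ℝ) + Δ ≤ b := by exact_mod_cast hba
  have hΔ : (0 : ℝ) ≤ Δ := Nat.cast_nonneg Δ
  have hlt : ((a : ℝ) + b) * (a + b + 2 * m - 2) / (a + Δ) <
      Fintype.card ↥((↑U : Set V)ᶜ) := by linarith
  rw [div_lt_iff₀ (by linarith)] at hlt
  refine hlt.trans_le ?_
  rw [mul_comm]
  gcongr
end

section
/- Let G be a finite simple graph and let a, b, n', m be non-negative integers with a ≤ b. Then G is a fractional (a,b,n',m)-critical deleted graph if and only if for every pair of disjoint vertex subsets S, T ⊆ V(G) with |S| ≥ n', for every U ⊆ S with |U| = n', and for every set H of m edges of G − U, we have b|S| + d_{G−S}(T) − a|T| ≥ b·n' + d_H(T) − e_H(T,S). -/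
open Classical Finset

namespace FracFactor

lemma fracDeg_eq_sum {V : Type*} [Fintype V] [DecidableEq V] (h : Sym2 V → ℝ) (x : V) :
    fracDeg h x = ∑ z, h s(x, z) := by
  unfold fracDeg
  symm
  refine Finset.sum_bij (fun z _ => s(x, z)) ?_ ?_ ?_ ?_
  · intro z _
    simp
  · intro z _ w _ hzw
    exact Sym2.congr_right.mp hzw
  · intro e he
    obtain ⟨z, rfl⟩ := (Finset.mem_filter.mp he).2
    exact ⟨z, Finset.mem_univ _, rfl⟩
  · intros
    rfl

lemma sum_mul_fracDeg {V : Type*} [Fintype V] [DecidableEq V] (h : Sym2 V → ℝ) (y : V → ℝ) :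
    ∑ x, y x * fracDeg h x = (∑ x, ∑ z, (y x + y z) * h s(x, z)) / 2 := by
  have hsplit : ∑ x, ∑ z, (y x + y z) * h s(x, z)
      = ∑ x, ∑ z, y x * h s(x, z) + ∑ x, ∑ z, y z * h s(x, z) := by
    simp only [add_mul, Finset.sum_add_distrib]
  have hswap : ∑ x, ∑ z, y z * h s(x, z) = ∑ x, ∑ z, y x * h s(x, z) := by
    rw [Finset.sum_comm]
    simp only [Sym2.eq_swap]
  rw [hsplit, hswap]
  simp only [fracDeg_eq_sum, Finset.mul_sum]
  ring

/-- The slack of the dual inequality of the fractional `(g,f)`-factor problem at the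
multiplier `y`. -/
noncomputable def dualSlack {V : Type*} [Fintype V] (G : SimpleGraph V) (g f : V → ℤ)
    (y : V → ℝ) : ℝ :=
  (∑ x, ∑ z, if G.Adj x z then max (y x + y z) 0 else 0) / 2
    - ∑ x, ((g x : ℝ) * max (y x) 0 - (f x : ℝ) * max (-y x) 0)

lemma dualSlack_nonneg_of_hasFracFactor {V : Type*} [Fintype V] [DecidableEq V]
    {G : SimpleGraph V} {g f : V → ℤ} (hG : HasFracFactor G g f) (y : V → ℝ) :
    0 ≤ dualSlack G g f y := by
  obtain ⟨h, h01, hoff, hdeg⟩ := hG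
  have hlow : ∑ x, ((g x : ℝ) * max (y x) 0 - (f x : ℝ) * max (-y x) 0)
      ≤ ∑ x, y x * fracDeg h x := by
    refine Finset.sum_le_sum fun x _ => ?_
    obtain ⟨h1, h2⟩ := hdeg x
    rcases le_total 0 (y x) with hy | hy
    · rw [max_eq_left hy, max_eq_right (by linarith)]
      nlinarith
    · rw [max_eq_right hy, max_eq_left (by linarith)]
      nlinarith
  have hup : ∑ x, ∑ z, (y x + y z) * h s(x, z)
      ≤ ∑ x, ∑ z, if G.Adj x z then max (y x + y z) 0 else 0 := by
    refine Finset.sum_le_sum fun x _ => Finset.sum_le_sum fun z _ => ?_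
    split_ifs with hadj
    · obtain ⟨h1, h2⟩ := h01 s(x, z)
      rcases le_total 0 (y x + y z) with hy | hy
      · rw [max_eq_left hy]
        nlinarith
      · rw [max_eq_right hy]
        nlinarith
    · rw [hoff s(x, z) (by simpa using hadj), mul_zero]
  rw [sum_mul_fracDeg] at hlow
  unfold dualSlack
  linarith

lemma hasFracFactor_of_dualSlack_nonneg {V : Type*} [Fintype V] [DecidableEq V]
    {G : SimpleGraph V} {g f : V → ℤ} (hgf : ∀ x, g x ≤ f x)
    (hG : ∀ y, 0 ≤ dualSlack G g f y) : HasFracFactor G g f := by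
  let D : (Sym2 V → ℝ) →ₗ[ℝ] (V → ℝ) :=
    { toFun := fun h x => ∑ z, h s(x, z)
      map_add' := fun h k => by
        ext x
        simp [Finset.sum_add_distrib]
      map_smul' := fun c h => by
        ext x
        simp [Finset.mul_sum] }
  have hD : Continuous D := D.continuous_of_finiteDimensional
  let K : Set (Sym2 V → ℝ) := Set.Icc 0 (fun e => if e ∈ G.edgeSet then 1 else 0)
  let B : Set (V → ℝ) := Set.Icc (fun x => (g x : ℝ)) (fun x => (f x : ℝ))
  by_cases hdisj : Disjoint (D '' K) B
  · exfalso
    obtain ⟨φ, u, v, hu, huv, hv⟩ := geometric_hahn_banach_compact_closed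
      ((convex_Icc _ _).linear_image D) (isCompact_Icc.image hD) (convex_Icc _ _)
      isClosed_Icc hdisj
    let y : V → ℝ := fun x => φ (Pi.single x 1)
    have hφ : ∀ p : V → ℝ, φ p = ∑ x, y x * p x := by
      intro p
      have := LinearMap.pi_apply_eq_sum_univ φ.toLinearMap p
      simp only [ContinuousLinearMap.coe_coe, smul_eq_mul] at this
      rw [this]
      refine Finset.sum_congr rfl fun x _ => ?_
      rw [mul_comm]
      congr 2
      ext z
      simp [Pi.single_apply, eq_comm]
    let h : Sym2 V → ℝ := fun e =>
      if e ∈ G.edgeSet ∧ 0 ≤ (Sym2.lift ⟨fun x z => y x + y z, fun _ _ => add_comm _ _⟩ e)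
      then 1 else 0
    have hhK : h ∈ K := by
      constructor
      · intro e
        simp only [h, Pi.zero_apply]
        split_ifs <;> norm_num
      · intro e
        simp only [h]
        split_ifs with h1 h2 <;> first | exact absurd h1.1 h2 | norm_num
    let p : V → ℝ := fun x => if 0 ≤ y x then (g x : ℝ) else f x
    have hpB : p ∈ B := by
      constructor
      · intro x
        have : (g x : ℝ) ≤ f x := by exact_mod_cast hgf x
        simp only [p]
        split_ifs <;> linarith
      · intro x
        have : (g x : ℝ) ≤ f x := by exact_mod_cast hgf x
        simp only [p]
        split_ifs <;> linarith
    have hDh : φ (D h) = (∑ x, ∑ z, if G.Adj x z then max (y x + y z) 0 else 0) / 2 := by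
      have : ∀ x, D h x = fracDeg h x := fun x => (fracDeg_eq_sum h x).symm
      rw [hφ]
      simp only [this]
      rw [sum_mul_fracDeg]
      congr 1
      refine Finset.sum_congr rfl fun x _ => Finset.sum_congr rfl fun z _ => ?_
      simp only [h, SimpleGraph.mem_edgeSet, Sym2.lift_mk]
      by_cases hadj : G.Adj x z
      · by_cases hy : 0 ≤ y x + y z
        · simp [hadj, hy]
        · simp [hadj, hy, max_eq_right (not_le.mp hy).le]
      · simp [hadj]
    have hp : φ p = ∑ x, ((g x : ℝ) * max (y x) 0 - (f x : ℝ) * max (-y x) 0) := by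
      rw [hφ]
      refine Finset.sum_congr rfl fun x _ => ?_
      simp only [p]
      split_ifs with hy
      · rw [max_eq_left hy, max_eq_right (by linarith)]
        ring
      · rw [max_eq_right (by linarith), max_eq_left (by linarith)]
        ring
    have h1 := hu _ ⟨h, hhK, rfl⟩
    have h2 := hv p hpB
    have h3 := hG y
    unfold dualSlack at h3
    linarith
  · obtain ⟨_, ⟨h, hK, rfl⟩, hB⟩ := Set.not_disjoint_iff.mp hdisj
    refine ⟨h, fun e => ⟨hK.1 e, ?_⟩, fun e he => ?_, fun x => ?_⟩
    · refine (hK.2 e).trans ?_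
      dsimp only
      split_ifs <;> norm_num
    · refine le_antisymm ?_ (hK.1 e)
      simpa [he] using hK.2 e
    · rw [fracDeg_eq_sum]
      exact ⟨hB.1 x, hB.2 x⟩

lemma max_add_peel {t p q : ℝ} (ht : 0 < t) (hp : p ≠ 0 → t ≤ |p|) (hq : q ≠ 0 → t ≤ |q|) :
    max (p + q) 0 = t * max (Real.sign p + Real.sign q) 0
      + max ((p - t * Real.sign p) + (q - t * Real.sign q)) 0 := by
  rcases lt_trichotomy p 0 with h | h | h <;> rcases lt_trichotomy q 0 with k | k | k
  all_goals
    first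
    | (have hp' := hp h.ne; rw [abs_of_neg h] at hp'; rw [Real.sign_of_neg h])
    | (have hp' := hp h.ne'; rw [abs_of_pos h] at hp'; rw [Real.sign_of_pos h])
    | (subst h; rw [Real.sign_zero])
    first
    | (have hq' := hq k.ne; rw [abs_of_neg k] at hq'; rw [Real.sign_of_neg k])
    | (have hq' := hq k.ne'; rw [abs_of_pos k] at hq'; rw [Real.sign_of_pos k])
    | (subst k; rw [Real.sign_zero])
    norm_num <;> grind

lemma dualSlack_peel {V : Type*} [Fintype V] (G : SimpleGraph V) (g f : V → ℤ) {t : ℝ}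
    (ht : 0 < t) (y : V → ℝ) (hy : ∀ x, y x ≠ 0 → t ≤ |y x|) :
    dualSlack G g f y = t * dualSlack G g f (fun x => Real.sign (y x))
      + dualSlack G g f (fun x => y x - t * Real.sign (y x)) := by
  have hpair : ∀ x z, (if G.Adj x z then max (y x + y z) 0 else 0)
      = t * (if G.Adj x z then max (Real.sign (y x) + Real.sign (y z)) 0 else 0)
      + (if G.Adj x z then
          max ((y x - t * Real.sign (y x)) + (y z - t * Real.sign (y z))) 0 else 0) := by
    intro x z
    split_ifs
    · exact max_add_peel ht (hy x) (hy z)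
    · ring
  have hpos : ∀ x, max (y x) 0
      = t * max (Real.sign (y x)) 0 + max (y x - t * Real.sign (y x)) 0 := by
    intro x
    simpa using max_add_peel ht (hy x) (q := 0) (by simp)
  have hneg : ∀ x, max (-y x) 0
      = t * max (-Real.sign (y x)) 0 + max (-(y x - t * Real.sign (y x))) 0 := by
    intro x
    have := max_add_peel ht (p := -y x) (q := 0) (by simpa using hy x) (by simp)
    simp only [Real.sign_neg, Real.sign_zero, add_zero, mul_zero, sub_zero] at this
    rw [this]
    ring_nf
  have hlin : ∀ x, (g x : ℝ) * max (y x) 0 - (f x : ℝ) * max (-y x) 0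
      = t * ((g x : ℝ) * max (Real.sign (y x)) 0 - (f x : ℝ) * max (-Real.sign (y x)) 0)
      + ((g x : ℝ) * max (y x - t * Real.sign (y x)) 0
        - (f x : ℝ) * max (-(y x - t * Real.sign (y x))) 0) := by
    intro x
    rw [hpos x, hneg x]
    ring
  unfold dualSlack
  rw [Finset.sum_congr rfl fun x _ => hlin x,
    Finset.sum_congr rfl fun x _ => Finset.sum_congr rfl fun z _ => hpair x z]
  simp only [Finset.sum_add_distrib, ← Finset.mul_sum]
  ring

lemma dualSlack_nonneg_of_sign {V : Type*} [Fintype V] {G : SimpleGraph V} {g f : V → ℤ}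
    (hsign : ∀ y : V → ℝ, 0 ≤ dualSlack G g f (fun x => Real.sign (y x))) (y : V → ℝ) :
    0 ≤ dualSlack G g f y := by
  induction hn : (univ.filter fun x => y x ≠ 0).card using Nat.strong_induction_on
    generalizing y with
  | _ n ih =>
    rcases (univ.filter fun x => y x ≠ 0).eq_empty_or_nonempty with hemp | hne
    · have h0 : ∀ x, y x = 0 := by
        intro x
        by_contra hx
        exact Finset.notMem_empty x (hemp ▸ by simpa using hx)
      obtain rfl : y = 0 := funext h0
      have h1 := hsign 0
      simp only [Pi.zero_apply, Real.sign_zero] at h1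
      exact h1
    · obtain ⟨w, hw, hmin⟩ := Finset.exists_min_image _ (fun x => |y x|) hne
      simp only [Finset.mem_filter, Finset.mem_univ, true_and] at hw hmin
      rw [dualSlack_peel G g f (abs_pos.mpr hw) y hmin]
      refine add_nonneg (mul_nonneg (abs_nonneg _) (hsign y)) (ih _ ?_ _ rfl)
      rw [← hn]
      refine Finset.card_lt_card (Finset.ssubset_iff_of_subset ?_ |>.mpr ⟨w, by simpa using hw, ?_⟩)
      · intro x
        simp only [Finset.mem_filter, Finset.mem_univ, true_and]
        intro hx h0
        simp [h0] at hx
      · rcases lt_or_gt_of_ne hw with h | h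
        · simp [Real.sign_of_neg h, abs_of_neg h]
        · simp [Real.sign_of_pos h, abs_of_pos h]

lemma dualSlack_indicator {V : Type*} [Fintype V] [DecidableEq V] (G : SimpleGraph V) (g f : V → ℤ)
    {S T : Finset V} (hST : Disjoint S T) (y : V → ℝ)
    (hy : ∀ x, y x = if x ∈ T then 1 else if x ∈ S then -1 else 0) :
    dualSlack G g f y
      = ((∑ x ∈ T, ((univ.filter fun z => G.Adj x z ∧ z ∉ S).card : ℤ)
          - (∑ x ∈ T, g x - ∑ x ∈ S, f x) : ℤ) : ℝ) := by
  have hmem : ∀ (A : Finset V) (φ : V → ℝ), ∑ x ∈ A, φ x = ∑ x, if x ∈ A then φ x else 0 := by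
    intro A φ
    simp
  have hlin : ∑ x, ((g x : ℝ) * max (y x) 0 - (f x : ℝ) * max (-y x) 0)
      = ∑ x ∈ T, (g x : ℝ) - ∑ x ∈ S, (f x : ℝ) := by
    rw [hmem T, hmem S, ← Finset.sum_sub_distrib]
    refine Finset.sum_congr rfl fun x _ => ?_
    have hx : x ∈ S → x ∉ T := fun h => Finset.disjoint_left.mp hST h
    rw [hy]
    by_cases h1 : x ∈ T <;> by_cases h2 : x ∈ S <;> simp_all
  have hpair : ∀ x z, (if G.Adj x z then max (y x + y z) 0 else 0)
      = (if x ∈ T ∧ G.Adj x z ∧ z ∉ S then (1 : ℝ) else 0)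
      + (if z ∈ T ∧ G.Adj z x ∧ x ∉ S then (1 : ℝ) else 0) := by
    intro x z
    have hx : x ∈ S → x ∉ T := fun h => Finset.disjoint_left.mp hST h
    have hz : z ∈ S → z ∉ T := fun h => Finset.disjoint_left.mp hST h
    rw [hy, hy, G.adj_comm z x]
    by_cases hadj : G.Adj x z <;> by_cases h1 : x ∈ T <;> by_cases h2 : x ∈ S <;>
      by_cases h3 : z ∈ T <;> by_cases h4 : z ∈ S <;> simp_all
  have hcount : ∑ x, ∑ z, (if x ∈ T ∧ G.Adj x z ∧ z ∉ S then (1 : ℝ) else 0)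
      = ∑ x ∈ T, ((univ.filter fun z => G.Adj x z ∧ z ∉ S).card : ℝ) := by
    rw [hmem T]
    refine Finset.sum_congr rfl fun x _ => ?_
    by_cases hx : x ∈ T <;> simp [hx]
  unfold dualSlack
  simp only [hpair, Finset.sum_add_distrib]
  rw [hlin, Finset.sum_comm (f := fun x z => if z ∈ T ∧ G.Adj z x ∧ x ∉ S then (1 : ℝ) else 0),
    hcount]
  push_cast
  ring

/-- The fractional `(g,f)`-factor theorem. -/
theorem hasFracFactor_iff {V : Type*} [Fintype V] [DecidableEq V] (G : SimpleGraph V)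
    {g f : V → ℤ} (hgf : ∀ x, g x ≤ f x) :
    HasFracFactor G g f ↔ ∀ S T : Finset V, Disjoint S T →
      ∑ x ∈ T, g x - ∑ x ∈ S, f x
        ≤ ∑ x ∈ T, ((univ.filter fun z => G.Adj x z ∧ z ∉ S).card : ℤ) := by
  constructor
  · intro hG S T hST
    have := dualSlack_nonneg_of_hasFracFactor hG
      (fun x => if x ∈ T then 1 else if x ∈ S then -1 else 0)
    rw [dualSlack_indicator G g f hST _ fun _ => rfl, Int.cast_nonneg_iff] at this
    exact sub_nonneg.mp this
  · intro hG
    refine hasFracFactor_of_dualSlack_nonneg hgf (dualSlack_nonneg_of_sign fun y => ?_)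
    obtain ⟨S, hS⟩ : ∃ S : Finset V, ∀ x, x ∈ S ↔ y x < 0 :=
      ⟨univ.filter fun x => y x < 0, by simp⟩
    obtain ⟨T, hT⟩ : ∃ T : Finset V, ∀ x, x ∈ T ↔ 0 < y x :=
      ⟨univ.filter fun x => 0 < y x, by simp⟩
    have hST : Disjoint S T :=
      Finset.disjoint_left.mpr fun x hx hx' => ((hS x).mp hx).not_gt ((hT x).mp hx')
    rw [dualSlack_indicator G g f hST, Int.cast_nonneg_iff]
    · exact sub_nonneg.mpr (hG _ _ hST)
    · intro x
      rcases lt_trichotomy (y x) 0 with h | h | h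
      · simp [hS, hT, Real.sign_of_neg h, h, h.not_gt]
      · simp [hS, hT, h]
      · simp [hT, Real.sign_of_pos h, h]

lemma card_filter_mem_eq {V : Type*} [Fintype V] [DecidableEq V] (H : Finset (Sym2 V)) (x : V) :
    (H.filter fun e => x ∈ e).card = (univ.filter fun z => s(x, z) ∈ H).card := by
  symm
  refine Finset.card_bij (fun z _ => s(x, z)) ?_ ?_ ?_
  · intro z hz
    simpa using hz
  · intro z _ w _ hzw
    exact Sym2.congr_right.mp hzw
  · intro e he
    obtain ⟨heH, z, rfl⟩ := Finset.mem_filter.mp he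
    exact ⟨z, by simpa using heH, rfl⟩

lemma card_filter_crossing_eq {V : Type*} [Fintype V] [DecidableEq V] (H : Finset (Sym2 V))
    {S T : Finset V} (hST : Disjoint S T) :
    (H.filter fun e => ∃ u ∈ T, ∃ v ∈ S, e = s(u, v)).card
      = ∑ x ∈ T, (univ.filter fun z => s(x, z) ∈ H ∧ z ∈ S).card := by
  rw [← Finset.card_sigma]
  symm
  refine Finset.card_bij (fun p _ => s(p.1, p.2)) ?_ ?_ ?_
  · rintro ⟨x, z⟩ hp
    simp only [Finset.mem_sigma, Finset.mem_filter, Finset.mem_univ, true_and] at hp ⊢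
    exact ⟨hp.2.1, x, hp.1, z, hp.2.2, rfl⟩
  · rintro ⟨x, z⟩ hp ⟨x', z'⟩ hp' heq
    simp only [Finset.mem_sigma, Finset.mem_filter, Finset.mem_univ, true_and] at hp hp'
    rcases Sym2.eq_iff.mp heq with ⟨rfl, rfl⟩ | ⟨rfl, rfl⟩
    · rfl
    · exact absurd hp.1 (Finset.disjoint_left.mp hST hp'.2.2)
  · intro e he
    obtain ⟨heH, u, hu, v, hv, rfl⟩ := Finset.mem_filter.mp he
    exact ⟨⟨u, v⟩, by simp [hu, hv, heH], rfl⟩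

lemma sum_card_delete_eq {V : Type*} [Fintype V] [DecidableEq V] (G : SimpleGraph V)
    [DecidableRel G.Adj] {S T : Finset V} (hST : Disjoint S T) {H : Finset (Sym2 V)}
    (hH : ↑H ⊆ G.edgeSet) :
    ∑ x ∈ T, ((univ.filter fun z => (G.Adj x z ∧ s(x, z) ∉ H) ∧ z ∉ S).card : ℤ)
      = ∑ x ∈ T, ((G.neighborFinset x \ S).card : ℤ)
        - (∑ x ∈ T, ((H.filter fun e => x ∈ e).card : ℤ)
          - ((H.filter fun e => ∃ u ∈ T, ∃ v ∈ S, e = s(u, v)).card : ℤ)) := by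
  rw [card_filter_crossing_eq H hST]
  push_cast
  rw [← Finset.sum_sub_distrib, ← Finset.sum_sub_distrib]
  refine Finset.sum_congr rfl fun x _ => ?_
  have h1 : (G.neighborFinset x \ S).card
      = (univ.filter fun z => (G.Adj x z ∧ s(x, z) ∉ H) ∧ z ∉ S).card
        + (univ.filter fun z => s(x, z) ∈ H ∧ z ∉ S).card := by
    rw [← Finset.card_union_of_disjoint]
    · congr 1
      ext z
      have : s(x, z) ∈ H → G.Adj x z := fun h => hH h
      simp only [Finset.mem_sdiff, SimpleGraph.mem_neighborFinset, Finset.mem_union,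
        Finset.mem_filter, Finset.mem_univ, true_and]
      tauto
    · refine Finset.disjoint_filter.mpr fun z _ h h' => h.1.2 h'.1
  have h2 : (H.filter fun e => x ∈ e).card
      = (univ.filter fun z => s(x, z) ∈ H ∧ z ∈ S).card
        + (univ.filter fun z => s(x, z) ∈ H ∧ z ∉ S).card := by
    rw [card_filter_mem_eq, ← Finset.card_filter_add_card_filter_not (fun z => z ∈ S),
      Finset.filter_filter, Finset.filter_filter]
  omega

lemma sum_card_map_eq {V W : Type*} [Fintype V] [Fintype W] [DecidableEq V]
    [DecidableEq W] (G : SimpleGraph V) [DecidableRel G.Adj] (i : W ↪ V) {U : Finset V}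
    (hU : ∀ v, v ∉ U ↔ v ∈ Set.range i)
    (S T : Finset W) {H : Finset (Sym2 W)} {G' : SimpleGraph W}
    (hG' : G' = (G.comap i).deleteEdges ↑H) :
    ∑ x ∈ T, ((univ.filter fun z => G'.Adj x z ∧ z ∉ S).card : ℤ)
      = ∑ x ∈ T.map i, ((univ.filter fun z =>
          (G.Adj x z ∧ s(x, z) ∉ H.map i.sym2Map) ∧ z ∉ U ∪ S.map i).card : ℤ) := by
  subst hG'
  rw [Finset.sum_map]
  refine Finset.sum_congr rfl fun x _ => ?_
  rw [← Finset.card_map i]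
  congr 2
  have hH : ∀ z, s(i x, i z) ∈ H.map i.sym2Map ↔ s(x, z) ∈ H := fun z =>
    Finset.mem_map' i.sym2Map (a := s(x, z))
  ext v
  by_cases hv : v ∈ U
  · have : ∀ z, i z ≠ v := fun z hz => (hU v).mpr ⟨z, hz⟩ hv
    simp [hv, this]
  · obtain ⟨z, rfl⟩ := (hU v).mp hv
    rw [Finset.mem_map']
    simp only [Finset.mem_filter, Finset.mem_univ, true_and, hH, Finset.mem_union, hv, false_or,
      Finset.mem_map', SimpleGraph.deleteEdges_adj, SimpleGraph.comap_adj, Finset.mem_coe]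

lemma hasFracFactor_comap_deleteEdges_iff {V W : Type*} [Fintype V] [Fintype W] [DecidableEq V]
    [DecidableEq W] (G : SimpleGraph V) [DecidableRel G.Adj] (i : W ↪ V) {U : Finset V}
    (hU : ∀ v, v ∉ U ↔ v ∈ Set.range i) {a b : ℤ} (hab : a ≤ b) {H : Finset (Sym2 W)}
    (hH : ↑H ⊆ (G.comap i).edgeSet) :
    HasFracFactor ((G.comap i).deleteEdges ↑H) (fun _ => a) (fun _ => b) ↔
      ∀ S T : Finset V, Disjoint S T → U ⊆ S →
        b * S.card + ∑ x ∈ T, ((G.neighborFinset x \ S).card : ℤ) - a * T.card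
          ≥ b * U.card + ∑ x ∈ T, (((H.map i.sym2Map).filter fun e => x ∈ e).card : ℤ)
            - (((H.map i.sym2Map).filter fun e => ∃ u ∈ T, ∃ v ∈ S, e = s(u, v)).card : ℤ) := by
  have hmapH : ↑(H.map i.sym2Map) ⊆ G.edgeSet := by
    intro e he
    obtain ⟨e', he', rfl⟩ := Finset.mem_map.mp (Finset.mem_coe.mp he)
    have := hH he'
    induction e' with
    | _ x y => exact this
  have hpre : ∀ A : Finset V, Disjoint U A → ∃ A' : Finset W, A'.map i = A := by
    intro A hA
    refine ⟨univ.filter fun w => i w ∈ A, ?_⟩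
    ext v
    simp only [Finset.mem_map, Finset.mem_filter, Finset.mem_univ, true_and]
    constructor
    · rintro ⟨w, hw, rfl⟩
      exact hw
    · intro hv
      obtain ⟨w, rfl⟩ := (hU v).mp (Finset.disjoint_right.mp hA hv)
      exact ⟨w, hv, rfl⟩
  have hUmap : ∀ A : Finset W, Disjoint U (A.map i) := by
    intro A
    refine Finset.disjoint_right.mpr fun v hv => ?_
    obtain ⟨w, _, rfl⟩ := Finset.mem_map.mp hv
    exact (hU _).mpr ⟨w, rfl⟩
  obtain ⟨G', hG'⟩ : ∃ G', G' = (G.comap i).deleteEdges ↑H := ⟨_, rfl⟩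
  have hiff : ∀ S T : Finset W, Disjoint S T →
      (∑ _x ∈ T, a - ∑ _x ∈ S, b ≤ ∑ x ∈ T,
          ((univ.filter fun z => G'.Adj x z ∧ z ∉ S).card : ℤ) ↔
        b * (U ∪ S.map i).card + ∑ x ∈ T.map i, ((G.neighborFinset x \ (U ∪ S.map i)).card : ℤ)
            - a * (T.map i).card
          ≥ b * U.card + ∑ x ∈ T.map i, (((H.map i.sym2Map).filter fun e => x ∈ e).card : ℤ)
            - (((H.map i.sym2Map).filter
                fun e => ∃ u ∈ T.map i, ∃ v ∈ U ∪ S.map i, e = s(u, v)).card : ℤ)) := by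
    intro S T hST
    have hdisj : Disjoint (U ∪ S.map i) (T.map i) :=
      Finset.disjoint_union_left.mpr ⟨hUmap T, (Finset.disjoint_map i).mpr hST⟩
    rw [sum_card_map_eq G i hU S T hG', sum_card_delete_eq G hdisj hmapH,
      Finset.card_union_of_disjoint (hUmap S), Finset.card_map, Finset.card_map]
    simp only [Finset.sum_const, nsmul_eq_mul]
    push_cast
    constructor <;> intro h <;> linarith
  rw [← hG', hasFracFactor_iff _ fun _ => hab]
  constructor
  · intro h S T hST hUS
    obtain ⟨T, rfl⟩ := hpre T (hST.mono_left hUS)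
    obtain ⟨S', hS'⟩ := hpre (S \ U) Finset.disjoint_sdiff
    obtain rfl : U ∪ S'.map i = S := by
      rw [hS', Finset.union_sdiff_of_subset hUS]
    have hST' := (Finset.disjoint_map i).mp (Finset.disjoint_union_left.mp hST).2
    exact (hiff S' T hST').mp (h S' T hST')
  · intro h S T hST
    exact (hiff S T hST).mpr (h _ _
      (Finset.disjoint_union_left.mpr ⟨hUmap T, (Finset.disjoint_map i).mpr hST⟩)
      Finset.subset_union_left)

end FracFactor

theorem statement_11 {V : Type*} [Fintype V] [DecidableEq V]
    (G : SimpleGraph V) [DecidableRel G.Adj] (a b n' m : ℕ) (hab : a ≤ b) :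
    FracCriticalDeleted G (fun _ => (a : ℤ)) (fun _ => (b : ℤ)) n' m ↔
      ∀ S T : Finset V, Disjoint S T → n' ≤ S.card →
        ∀ U ⊆ S, U.card = n' →
          ∀ H : Finset (Sym2 V), (∀ e ∈ H, e ∈ G.edgeSet ∧ ∀ u ∈ U, u ∉ e) → H.card = m →
            (b : ℤ) * S.card + ∑ x ∈ T, ((G.neighborFinset x \ S).card : ℤ) - (a : ℤ) * T.card
              ≥ (b : ℤ) * n' + ∑ x ∈ T, ((H.filter (fun e => x ∈ e)).card : ℤ)
                - ((H.filter (fun e => ∃ u ∈ T, ∃ v ∈ S, e = s(u, v))).card : ℤ) := by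
  let i (U : Finset V) : ((↑U : Set V)ᶜ : Set V) ↪ V := Function.Embedding.subtype _
  have hU : ∀ (U : Finset V) v, v ∉ U ↔ v ∈ Set.range (i U) := by
    intro U v
    simp [i]
  have hab' : (a : ℤ) ≤ b := by exact_mod_cast hab
  constructor
  · rintro hG S T hST - U hUS rfl H hH rfl
    let H' := univ.filter fun e => (i U).sym2Map e ∈ H
    have hmap : H'.map (i U).sym2Map = H := by
      ext e
      simp only [H', Finset.mem_map, Finset.mem_filter, Finset.mem_univ, true_and]
      constructor
      · rintro ⟨e', he', rfl⟩
        exact he'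
      · intro he
        have hout := (hH e he).2
        induction e with
        | _ x y =>
          obtain ⟨x, rfl⟩ := (hU U x).mp fun hx => hout x hx (by simp)
          obtain ⟨y, rfl⟩ := (hU U y).mp fun hy => hout y hy (by simp)
          exact ⟨s(x, y), he, rfl⟩
    have hsub : ↑H' ⊆ (G.comap (i U)).edgeSet := by
      intro e he
      have := (hH _ (Finset.mem_filter.mp he).2).1
      induction e with
      | _ x y => exact this
    have hcard : H'.card = H.card := by rw [← hmap, Finset.card_map]
    have := (FracFactor.hasFracFactor_comap_deleteEdges_iff G (i U) (hU U) hab' hsub).mp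
      (hG U rfl H' hsub hcard) S T hST hUS
    rwa [hmap] at this
  · rintro hG U rfl H hH rfl
    refine (FracFactor.hasFracFactor_comap_deleteEdges_iff G (i U) (hU U) hab' hH).mpr ?_
    intro S T hST hUS
    refine hG S T hST (Finset.card_le_card hUS) U hUS rfl (H.map (i U).sym2Map) ?_
      (Finset.card_map _)
    intro e he
    obtain ⟨e', he', rfl⟩ := Finset.mem_map.mp he
    have hedge := hH he'
    induction e' with
    | _ x y =>
      refine ⟨hedge, fun u hu hmem => ?_⟩
      rcases Sym2.mem_iff.mp hmem with rfl | rfl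
      · exact (hU U _).mpr ⟨x, rfl⟩ hu
      · exact (hU U _).mpr ⟨y, rfl⟩ hu
end

section
/- Let G be a finite simple graph of order n, and let a, b, n', m, Δ be non-negative integers with b − Δ ≥ a ≥ 2, δ(G) ≥ b(b−Δ)/(a+Δ) + m + n', and n > (a+b)(a+b+2m−2)/(a+Δ) + n'. If for every pair of distinct non-adjacent vertices u, v of G we have d_G(u) + d_G(v) ≥ 2((b−Δ)n + (a+Δ)n')/(a+b), then G is a fractional (a,b,n',m)-critical deleted graph. -/
open Classical Finset

namespace SimpleGraph

variable {V : Type*} [Fintype V] [DecidableEq V]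

/-- The fractional degrees of a symmetric weight on ordered pairs are its row sums. -/
lemma fracDeg_lift (w : V → V → ℝ) (hw : ∀ x y, w x y = w y x) (x : V) :
    fracDeg (Sym2.lift ⟨w, hw⟩) x = ∑ y, w x y := by
  unfold fracDeg
  symm
  refine Finset.sum_nbij (fun y => s(x, y)) ?_ ?_ ?_ ?_
  · intro y _
    simp
  · intro y _ z _ hyz
    exact Sym2.congr_right.mp hyz
  · intro e he
    have hx : x ∈ e := by simpa using he
    obtain ⟨y, rfl⟩ := Sym2.mem_iff_exists.mp hx
    exact ⟨y, by simp, rfl⟩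
  · intro y _
    simp

/-- Layer-cake form of the cut condition: nonnegativity on all pairs of disjoint sets
gives nonnegativity for all real potentials. -/
lemma potential_nonneg (G : SimpleGraph V) (g f : V → ℝ)
    (hcut : ∀ S T : Finset V, Disjoint S T →
      ∑ x ∈ T, g x ≤ ∑ x ∈ S, f x + ∑ x ∈ T, (#{y | y ∉ S ∧ G.Adj x y} : ℝ))
    (p : V → ℝ) :
    0 ≤ ∑ x, f x * max (-p x) 0 - ∑ x, g x * max (p x) 0 +
      ∑ x, ∑ y, if G.Adj x y then max (p x - max (-p y) 0) 0 else 0 := by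
  have hi : ∀ c d : ℝ, MeasureTheory.Integrable ((Set.Ioc c d).indicator fun _ => (1 : ℝ)) := by
    intro c d
    exact (MeasureTheory.integrable_indicator_iff measurableSet_Ioc).2
      (MeasureTheory.integrableOn_const (by simp))
  have hv : ∀ c d : ℝ, ∫ θ, (Set.Ioc c d).indicator (fun _ => (1 : ℝ)) θ = max (d - c) 0 := by
    intro c d
    rw [MeasureTheory.integral_indicator measurableSet_Ioc]
    simp [MeasureTheory.measureReal_def, ENNReal.toReal_ofReal']
  have key : ∀ θ : ℝ, 0 ≤
      ∑ x, f x * (Set.Ioc 0 (-p x)).indicator (fun _ => (1 : ℝ)) θ -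
      ∑ x, g x * (Set.Ioc 0 (p x)).indicator (fun _ => (1 : ℝ)) θ +
      ∑ x, ∑ y, (if G.Adj x y then 1 else 0) *
        (Set.Ioc (max (-p y) 0) (p x)).indicator (fun _ => (1 : ℝ)) θ := by
    intro θ
    by_cases hθ : 0 < θ
    · have hd : Disjoint ({x | θ ≤ -p x} : Finset V) ({x | θ ≤ p x} : Finset V) := by
        rw [Finset.disjoint_left]
        intro x hx hx'
        simp only [mem_filter, mem_univ, true_and] at hx hx'
        linarith
      have h := hcut _ _ hd
      have e1 : ∑ x, f x * (Set.Ioc 0 (-p x)).indicator (fun _ => (1 : ℝ)) θ =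
          ∑ x ∈ ({x | θ ≤ -p x} : Finset V), f x := by
        rw [Finset.sum_filter]
        refine Finset.sum_congr rfl fun x _ => ?_
        simp [Set.indicator_apply, hθ]
      have e2 : ∑ x, g x * (Set.Ioc 0 (p x)).indicator (fun _ => (1 : ℝ)) θ =
          ∑ x ∈ ({x | θ ≤ p x} : Finset V), g x := by
        rw [Finset.sum_filter]
        refine Finset.sum_congr rfl fun x _ => ?_
        simp [Set.indicator_apply, hθ]
      have e3 : ∑ x, ∑ y, (if G.Adj x y then 1 else 0) *
            (Set.Ioc (max (-p y) 0) (p x)).indicator (fun _ => (1 : ℝ)) θ =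
          ∑ x ∈ ({x | θ ≤ p x} : Finset V),
            (#{y | y ∉ ({x | θ ≤ -p x} : Finset V) ∧ G.Adj x y} : ℝ) := by
        rw [Finset.sum_filter]
        refine Finset.sum_congr rfl fun x _ => ?_
        split_ifs with hx
        · rw [Finset.card_filter]
          push_cast
          refine Finset.sum_congr rfl fun y _ => ?_
          by_cases hadj : G.Adj x y <;> simp [Set.indicator_apply, hθ, hx, hadj]
        · refine Finset.sum_eq_zero fun y _ => ?_
          simp [hx]
      rw [e1, e2, e3]
      linarith
    · refine le_of_eq ?_
      simp [hθ]
  have hnonneg := MeasureTheory.integral_nonneg (μ := MeasureTheory.volume)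
    (show (0 : ℝ → ℝ) ≤ fun θ => _ from key)
  rw [MeasureTheory.integral_add, MeasureTheory.integral_sub, MeasureTheory.integral_finsetSum,
    MeasureTheory.integral_finsetSum, MeasureTheory.integral_finsetSum] at hnonneg
  · simp_rw [MeasureTheory.integral_const_mul, hv, sub_zero] at hnonneg
    refine hnonneg.trans_eq ?_
    congr 1
    refine Finset.sum_congr rfl fun x _ => ?_
    rw [MeasureTheory.integral_finsetSum]
    · refine Finset.sum_congr rfl fun y _ => ?_
      rw [MeasureTheory.integral_const_mul, hv]
      split_ifs <;> simp
    · exact fun y _ => (hi _ _).const_mul _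
  · exact fun x _ => MeasureTheory.integrable_finsetSum _ fun y _ => (hi _ _).const_mul _
  · exact fun x _ => (hi _ _).const_mul _
  · exact fun x _ => (hi _ _).const_mul _
  · exact MeasureTheory.integrable_finsetSum _ fun x _ => (hi _ _).const_mul _
  · exact MeasureTheory.integrable_finsetSum _ fun x _ => (hi _ _).const_mul _
  · exact (MeasureTheory.integrable_finsetSum _ fun x _ => (hi _ _).const_mul _).sub
      (MeasureTheory.integrable_finsetSum _ fun x _ => (hi _ _).const_mul _)
  · exact MeasureTheory.integrable_finsetSum _ fun x _ =>
      MeasureTheory.integrable_finsetSum _ fun y _ => (hi _ _).const_mul _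

lemma max_sub_add_max_sub (u v : ℝ) :
    max (u - max (-v) 0) 0 + max (v - max (-u) 0) 0 = max (u + v) 0 := by
  rcases le_total u 0 with hu | hu <;> rcases le_total v 0 with hv | hv <;>
    rcases le_total (u + v) 0 with huv | huv <;> simp [max_def] <;> split_ifs <;> linarith

/-- Sufficiency in Anstee's characterisation of graphs with a fractional `(g,f)`-factor. -/
theorem hasFracFactor_of_cut (G : SimpleGraph V) (g f : V → ℤ) (hgf : ∀ x, g x ≤ f x)
    (hcut : ∀ S T : Finset V, Disjoint S T →
      ∑ x ∈ T, g x ≤ ∑ x ∈ S, f x + ∑ x ∈ T, (#{y | y ∉ S ∧ G.Adj x y} : ℤ)) :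
    HasFracFactor G g f := by
  let K : Set (V → V → ℝ) := Set.Icc 0 1 ∩
    {w | ∀ x y, w x y = w y x ∧ (¬ G.Adj x y → w x y = 0)}
  let L : (V → V → ℝ) →ₗ[ℝ] (V → ℝ) :=
    { toFun := fun w x => ∑ y, w x y
      map_add' := fun w w' => by ext x; simp [Finset.sum_add_distrib]
      map_smul' := fun c w => by ext x; simp [Finset.mul_sum] }
  let B : Set (V → ℝ) := Set.Icc (fun x => (g x : ℝ)) (fun x => (f x : ℝ))
  by_cases hdisj : Disjoint (L '' K) B
  · exfalso
    have hKc : IsCompact K := by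
      refine (isCompact_Icc).inter_right ?_
      simp only [Set.ofPred_forall, Set.ofPred_and]
      refine isClosed_iInter fun x => isClosed_iInter fun y => IsClosed.inter ?_ ?_
      · exact isClosed_eq (by fun_prop) (by fun_prop)
      · by_cases hxy : G.Adj x y
        · simp [hxy]
        · simpa [hxy] using isClosed_eq (f := fun w : V → V → ℝ => w x y) (by fun_prop)
            continuous_const
    have hKconv : Convex ℝ K := by
      refine (convex_Icc 0 1).inter ?_
      intro w hw w' hw' c d _ _ _ x y
      refine ⟨?_, fun hxy => ?_⟩
      · simp [(hw x y).1, (hw' x y).1]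
      · simp [(hw x y).2 hxy, (hw' x y).2 hxy]
    obtain ⟨φ, u, v, hu, huv, hv⟩ := geometric_hahn_banach_compact_closed
      (hKconv.linear_image L) (hKc.image L.continuous_of_finiteDimensional)
      (convex_Icc _ _) isClosed_Icc hdisj
    set p : V → ℝ := fun x => φ (Pi.single x 1) with hp
    have hφ : ∀ z : V → ℝ, φ z = ∑ x, p x * z x := by
      intro z
      conv_lhs => rw [pi_eq_sum_univ' z]
      simp [hp, mul_comm]
    let w : V → V → ℝ := fun x y => if G.Adj x y ∧ 0 < p x + p y then 1 else 0
    have hw : w ∈ K := by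
      refine ⟨⟨fun x y => ?_, fun x y => ?_⟩, fun x y => ⟨?_, fun hxy => ?_⟩⟩
      · simp only [w]; split_ifs <;> simp
      · simp only [w]; split_ifs <;> simp
      · simp only [w, G.adj_comm x y, add_comm (p x)]
      · simp [w, hxy]
    let z : V → ℝ := fun x => if 0 < p x then g x else f x
    have hz : z ∈ B := by
      have hgf' : ∀ x, (g x : ℝ) ≤ f x := fun x => by exact_mod_cast hgf x
      refine ⟨fun x => ?_, fun x => ?_⟩
      · simp only [z]; split_ifs
        · exact le_rfl
        · exact hgf' x
      · simp only [z]; split_ifs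
        · exact hgf' x
        · exact le_rfl
    have hlt : φ (L w) < φ z := (hu _ ⟨w, hw, rfl⟩).trans (huv.trans (hv _ hz))
    rw [hφ, hφ] at hlt
    have hpot := potential_nonneg G (fun x => (g x : ℝ)) (fun x => (f x : ℝ))
      (fun S T hST => by exact_mod_cast hcut S T hST) p
    have e1 : ∑ x, p x * z x =
        ∑ x, (g x : ℝ) * max (p x) 0 - ∑ x, (f x : ℝ) * max (-p x) 0 := by
      rw [← Finset.sum_sub_distrib]
      refine Finset.sum_congr rfl fun x _ => ?_
      simp only [z]
      split_ifs with hx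
      · rw [max_eq_left hx.le, max_eq_right (by linarith)]; ring
      · rw [max_eq_right (by linarith), max_eq_left (by linarith)]; ring
    have hswap : ∀ F : V → V → ℝ, 2 * ∑ x, ∑ y, F x y = ∑ x, ∑ y, (F x y + F y x) := by
      intro F
      simp only [Finset.sum_add_distrib]
      rw [Finset.sum_comm (f := fun x y => F y x)]
      ring
    have e2 : ∑ x, p x * L w x =
        ∑ x, ∑ y, if G.Adj x y then max (p x - max (-p y) 0) 0 else 0 := by
      have h2 : 2 * ∑ x, ∑ y, p x * w x y =
          2 * ∑ x, ∑ y, if G.Adj x y then max (p x - max (-p y) 0) 0 else 0 := by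
        rw [hswap, hswap]
        refine Finset.sum_congr rfl fun x _ => Finset.sum_congr rfl fun y _ => ?_
        simp only [w, G.adj_comm y x, add_comm (p y)]
        by_cases hxy : G.Adj x y
        · simp only [hxy, true_and, if_true]
          rw [max_sub_add_max_sub]
          split_ifs with h
          · rw [max_eq_left h.le]; ring
          · rw [max_eq_right (by linarith)]; ring
        · simp [hxy]
      have h3 : ∀ x, p x * L w x = ∑ y, p x * w x y := fun x => by
        simp [L, Finset.mul_sum]
      simp only [h3]
      linarith
    rw [e1, e2] at hlt
    linarith
  · obtain ⟨_, ⟨w, hw, rfl⟩, hB⟩ := Set.not_disjoint_iff.mp hdisj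
    refine ⟨Sym2.lift ⟨w, fun x y => (hw.2 x y).1⟩, ?_, ?_, fun x => ?_⟩
    · intro e
      induction e with
      | h x y => exact ⟨hw.1.1 x y, hw.1.2 x y⟩
    · intro e
      induction e with
      | h x y => exact fun hxy => (hw.2 x y).2 (by simpa using hxy)
    · rw [fracDeg_lift]
      exact ⟨hB.1 x, hB.2 x⟩

/-- The ends of the edges of `H`, counted at the vertices of `T`. -/
lemma sum_card_incident_le (H : Finset (Sym2 V)) (T : Finset V) :
    ∑ x ∈ T, #{y | s(x, y) ∈ H} ≤ 2 * #H := by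
  have h1 : ∀ x ∈ T, #{y | s(x, y) ∈ H} ≤ #{e ∈ H | x ∈ e} := by
    intro x _
    refine Finset.card_le_card_of_injOn (fun y => s(x, y)) ?_ ?_
    · intro y hy
      simpa using hy
    · intro y _ z _ hyz
      exact Sym2.congr_right.mp hyz
  refine (Finset.sum_le_sum h1).trans ?_
  have h2 := Finset.sum_card_bipartiteAbove_eq_sum_card_bipartiteBelow
    (s := T) (t := H) (fun x e => x ∈ e)
  simp only [Finset.bipartiteAbove, Finset.bipartiteBelow] at h2
  rw [h2, mul_comm]
  refine Finset.sum_le_card_nsmul _ _ _ fun e _ => ?_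
  induction e with
  | h x y =>
    refine (Finset.card_le_card (t := {x, y}) ?_).trans Finset.card_le_two
    intro z hz
    simpa using (Finset.mem_filter.mp hz).2

lemma card_incident_le (H : Finset (Sym2 V)) (x : V) : #{y | s(x, y) ∈ H} ≤ #H := by
  refine Finset.card_le_card_of_injOn (fun y => s(x, y)) ?_ ?_
  · intro y hy
    simpa using hy
  · intro y _ z _ hyz
    exact Sym2.congr_right.mp hyz

/-- The numerical contradiction when the two small degrees outside `S` are `h₁ ≤ h₂ ≤ a`. -/
lemma cut_arith {a b m N s t h₁ h₂ : ℤ} (hab : a ≤ b) (ha : 2 ≤ a) (hm : 0 ≤ m)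
    (hN : (a + b) * (a + b + 2 * m - 2) < b * N)
    (hst : s + t ≤ N) (h0 : 0 ≤ h₁) (h12 : h₁ ≤ h₂) (h2 : 1 ≤ h₂) (h2a : h₂ ≤ a)
    (hsum : 2 * a * N ≤ (a + b) * (2 * s + h₁ + h₂))
    (hdef : b * s + (h₂ - a) * t - (h₂ - h₁) * (h₁ + 1) ≤ 2 * m - 1) : False := by
  have e1 : (a + b - h₂) * s - (a - h₂) * N - (h₂ - h₁) * (h₁ + 1) ≤ 2 * m - 1 := by
    nlinarith [mul_nonneg (sub_nonneg.2 h2a) (sub_nonneg.2 hst)]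
  have e2 := mul_le_mul_of_nonneg_left hsum (by linarith : 0 ≤ a + b - h₂)
  have e3 := mul_lt_mul_of_pos_left hN (by linarith : 0 < h₂)
  have e4 := mul_le_mul_of_nonneg_left e1 (by linarith : 0 ≤ 2 * (a + b))
  have e5 : (a + b) * (2 * h₂ * (a + b + 2 * m - 2) - (a + b - h₂) * (h₁ + h₂)
      - 2 * (h₂ - h₁) * (h₁ + 1) - 2 * (2 * m - 1)) < 0 := by linarith
  have e6 : 2 * h₂ * (a + b + 2 * m - 2) - (a + b - h₂) * (h₁ + h₂)
      - 2 * (h₂ - h₁) * (h₁ + 1) - 2 * (2 * m - 1) < 0 := by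
    by_contra! h
    exact absurd e5 (not_lt.2 (mul_nonneg (by linarith) h))
  obtain ⟨k, rfl⟩ : ∃ k, h₁ = h₂ - k := ⟨h₂ - h₁, by ring⟩
  have hk : 0 ≤ k := by linarith
  have hmh := mul_nonneg hm (sub_nonneg.2 h2)
  have e7 : 2 * (h₂ * (h₂ - 2)) + k * ((a + b) - 3 * h₂ - 2 + 2 * k) + 2 < 0 := by
    nlinarith
  rcases h2.eq_or_lt with h | h
  · subst h
    have : 0 ≤ k * (a + b - 4) := mul_nonneg hk (by linarith)
    nlinarith
  · have : 0 ≤ k * (a + b - 2 * h₂) := mul_nonneg hk (by linarith)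
    nlinarith [sq_nonneg (4 * k - h₂ - 2)]

/-- The cut condition for a graph with `m` edges deleted, from its minimum degree and its
degree sums of non-adjacent pairs. -/
lemma cut_deleteEdges (G : SimpleGraph V) [DecidableRel G.Adj] {a b m : ℕ} (hab : a ≤ b) (ha : 2 ≤ a)
    (hmin : ∀ x, a + m ≤ G.degree x)
    (hN : ((a : ℤ) + b) * (a + b + 2 * m - 2) < b * Fintype.card V)
    (hdeg : ∀ x y, x ≠ y → ¬ G.Adj x y →
      2 * a * Fintype.card V ≤ (a + b) * (G.degree x + G.degree y))
    (H : Finset (Sym2 V)) (hH : #H = m) (S T : Finset V) (hST : Disjoint S T) :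
    (a : ℤ) * #T ≤ b * #S + ∑ x ∈ T, (#{y | y ∉ S ∧ (G.deleteEdges ↑H).Adj x y} : ℤ) := by
  by_contra! hlt
  set d : V → ℕ := fun x => #{y | y ∉ S ∧ G.Adj x y} with hd
  set d' : V → ℕ := fun x => #{y | y ∉ S ∧ (G.deleteEdges ↑H).Adj x y} with hd'
  change (b : ℤ) * #S + ∑ x ∈ T, (d' x : ℤ) < a * #T at hlt
  have hdd : ∀ x, d x ≤ d' x + #{y | s(x, y) ∈ H} := by
    intro x
    refine (Finset.card_le_card ?_).trans (Finset.card_union_le _ _)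
    intro y hy
    simp only [mem_filter, mem_univ, true_and, mem_union, deleteEdges_adj, mem_coe] at hy ⊢
    tauto
  have hdS : ∀ x, G.degree x ≤ d x + #S := by
    intro x
    rw [← G.card_neighborFinset_eq_degree]
    refine (Finset.card_le_card ?_).trans (Finset.card_union_le _ _)
    intro y hy
    simp only [mem_neighborFinset, mem_filter, mem_univ, true_and, mem_union] at hy ⊢
    tauto
  have hsumd : (∑ x ∈ T, (d x : ℤ)) ≤ ∑ x ∈ T, (d' x : ℤ) + 2 * m := by
    have h1 := Finset.sum_le_sum fun x (_ : x ∈ T) => hdd x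
    rw [Finset.sum_add_distrib] at h1
    have h2 := sum_card_incident_le H T
    rw [hH] at h2
    exact_mod_cast h1.trans (Nat.add_le_add_left h2 _)
  have hlow : ∀ x, (a : ℤ) + m - #S ≤ d x := fun x => by
    have := (hmin x).trans (hdS x)
    omega
  have hlow' : ∀ x, (a : ℤ) - #S ≤ d' x := fun x => by
    have h1 := hlow x
    have h2 := (hdd x).trans (Nat.add_le_add_left (card_incident_le H x) _)
    omega
  have hcard : (#S : ℤ) + #T ≤ Fintype.card V := by
    rw [← Nat.cast_add, ← Finset.card_union_of_disjoint hST]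
    exact_mod_cast Finset.card_le_univ _
  have hs0 : (0 : ℤ) ≤ #S := by positivity
  have ht0 : (0 : ℤ) ≤ #T := by positivity
  have hm0 : (0 : ℤ) ≤ m := by positivity
  have hab' : (a : ℤ) ≤ b := by exact_mod_cast hab
  have ha' : (2 : ℤ) ≤ a := by exact_mod_cast ha
  have hd'0 : (0 : ℤ) ≤ ∑ x ∈ T, (d' x : ℤ) := Finset.sum_nonneg fun x _ => by positivity
  have hbt : (b : ℤ) < #T := by
    have h1 := Finset.card_nsmul_le_sum T (fun x => (d' x : ℤ)) _ fun x _ => hlow' x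
    rw [nsmul_eq_mul] at h1
    have h2 : (0 : ℤ) < #S * (#T - b) := by linarith
    linarith [pos_of_mul_pos_right h2 hs0]
  have hms : (m : ℤ) < #S := by
    have h1 := Finset.card_nsmul_le_sum T (fun x => (d x : ℤ)) _ fun x _ => hlow x
    rw [nsmul_eq_mul] at h1
    by_contra! h
    nlinarith [mul_nonneg (sub_nonneg.2 hbt.le) (sub_nonneg.2 h)]
  have hTne : T.Nonempty := Finset.card_pos.mp (by omega)
  obtain ⟨x₁, hx₁, hmin₁⟩ := Finset.exists_min_image T d hTne
  have hsum₁ := Finset.card_nsmul_le_sum T (fun x => (d x : ℤ)) (d x₁) fun x hx => by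
    exact_mod_cast hmin₁ x hx
  rw [nsmul_eq_mul] at hsum₁
  have hd₁ : (d x₁ : ℤ) < a := by
    by_contra! h
    nlinarith [mul_nonneg ht0 (sub_nonneg.2 h)]
  set P : Finset V := {y ∈ T | y = x₁ ∨ G.Adj x₁ y} with hP
  have hPT : P ⊆ T := Finset.filter_subset _ _
  have hp : #P ≤ d x₁ + 1 := by
    refine (Finset.card_le_card (t := insert x₁ _) ?_).trans (Finset.card_insert_le _ _)
    intro y hy
    simp only [hP, mem_filter, mem_univ, true_and, mem_insert] at hy ⊢
    have := Finset.disjoint_right.mp hST hy.1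
    tauto
  have hp' : (#P : ℤ) ≤ d x₁ + 1 := by exact_mod_cast hp
  have hsplit : (#(T \ P) : ℤ) = #T - #P := by
    rw [Finset.card_sdiff_of_subset hPT, Nat.cast_sub (Finset.card_le_card hPT)]
  have hne : (T \ P).Nonempty := by
    by_contra! h
    rw [h, Finset.card_empty, Nat.cast_zero] at hsplit
    linarith
  obtain ⟨x₂, hx₂, hmin₂⟩ := Finset.exists_min_image _ d hne
  obtain ⟨hx₂T, hx₂P⟩ := Finset.mem_sdiff.mp hx₂
  have hx₂' : x₂ ≠ x₁ ∧ ¬ G.Adj x₁ x₂ := by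
    simpa [hP, hx₂T] using hx₂P
  have h12 : d x₁ ≤ d x₂ := hmin₁ x₂ hx₂T
  have h12' : (d x₁ : ℤ) ≤ d x₂ := by exact_mod_cast h12
  have hsum₂ := Finset.card_nsmul_le_sum (T \ P) (fun x => (d x : ℤ)) (d x₂) fun x hx => by
    exact_mod_cast hmin₂ x hx
  have hsum₃ := Finset.card_nsmul_le_sum P (fun x => (d x : ℤ)) (d x₁) fun x hx => by
    exact_mod_cast hmin₁ x (hPT hx)
  rw [nsmul_eq_mul] at hsum₂ hsum₃
  rw [hsplit] at hsum₂
  have hsum := Finset.sum_sdiff hPT (f := fun x => (d x : ℤ))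
  have hdef : (b : ℤ) * #S + (d x₂ - a) * #T - (d x₂ - d x₁) * (d x₁ + 1) ≤ 2 * m - 1 := by
    have h1 := mul_nonneg (sub_nonneg.2 h12') (sub_nonneg.2 hp')
    have h2 : (b : ℤ) * #S + ∑ x ∈ T, (d' x : ℤ) + 1 ≤ a * #T := hlt
    linarith
  have hds : 2 * (a : ℤ) * Fintype.card V ≤ (a + b) * (2 * #S + d x₁ + d x₂) := by
    have h1 := hdeg x₁ x₂ hx₂'.1.symm hx₂'.2
    have h2 := Nat.mul_le_mul_left (a + b) (Nat.add_le_add (hdS x₁) (hdS x₂))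
    have h3 := h1.trans h2
    zify at h3
    linarith
  have hlow₁ := hlow x₁
  rcases le_or_gt (d x₂ : ℤ) a with h2a | h2a
  · rcases Nat.eq_zero_or_pos (d x₂) with h0 | h0
    · have h1 : d x₁ = 0 := by omega
      rw [h0, h1] at hds
      push_cast at hds
      nlinarith
    · exact cut_arith hab' ha' hm0 hN hcard (by positivity) h12' (by exact_mod_cast h0) h2a hds hdef
  · have e1 : (0 : ℤ) ≤ (d x₂ - a) * (#T - (d x₁ + 1)) := mul_nonneg (by linarith) (by linarith)
    have e2 : (0 : ℤ) ≤ (a - d x₁) * (b - (d x₁ + 1)) := mul_nonneg (by linarith) (by linarith)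
    have e3 : (0 : ℤ) ≤ b * (#S - (a + m - d x₁)) := mul_nonneg (by linarith) (by linarith)
    nlinarith [mul_nonneg hm0 (by linarith : (0 : ℤ) ≤ b - 2)]

lemma degree_le_degree_induce_compl_add_card (G : SimpleGraph V) [DecidableRel G.Adj] (U : Finset V)
    (x : ((↑U : Set V)ᶜ : Set V)) :
    G.degree x ≤ (G.induce (↑U : Set V)ᶜ).degree x + #U := by
  rw [← card_neighborFinset_eq_degree, ← card_neighborFinset_eq_degree,
    ← Finset.card_map (Function.Embedding.subtype _)]
  refine (Finset.card_le_card ?_).trans (Finset.card_union_le _ _)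
  intro y hy
  by_cases hyU : y ∈ U
  · exact Finset.mem_union_right _ hyU
  · refine Finset.mem_union_left _ (Finset.mem_map.2 ⟨⟨y, by simpa using hyU⟩, ?_, rfl⟩)
    simpa using hy

end SimpleGraph

theorem statement_18 {V : Type*} [Fintype V] [DecidableEq V]
    (G : SimpleGraph V) [DecidableRel G.Adj] (a b n' m Δ : ℕ)
    (hba : a + Δ ≤ b) (ha : 2 ≤ a)
    (hmin : ∀ v : V, (G.degree v : ℝ) ≥
      (b : ℝ) * ((b : ℝ) - Δ) / ((a : ℝ) + Δ) + m + n')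
    (hn : (Fintype.card V : ℝ) >
      ((a : ℝ) + b) * ((a : ℝ) + b + 2 * m - 2) / ((a : ℝ) + Δ) + n')
    (hdeg : ∀ u v : V, u ≠ v → ¬ G.Adj u v →
      ((G.degree u : ℝ) + (G.degree v : ℝ)) ≥
        2 * (((b : ℝ) - Δ) * Fintype.card V + ((a : ℝ) + Δ) * n') / ((a : ℝ) + b)) :
    FracCriticalDeleted G (fun _ => (a : ℤ)) (fun _ => (b : ℤ)) n' m := by
  have hba' : (a : ℝ) + Δ ≤ b := by exact_mod_cast hba
  have ha' : (2 : ℝ) ≤ a := by exact_mod_cast ha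
  have hΔ : (0 : ℝ) ≤ Δ := by positivity
  have hm : (0 : ℝ) ≤ m := by positivity
  have hα : (0 : ℝ) < a + Δ := by linarith
  have hc : (0 : ℝ) < (a : ℝ) + b := by linarith
  have hab : a ≤ b := by omega
  intro U hU H _ hHm
  have hcard : (Fintype.card ((↑U : Set V)ᶜ : Set V) : ℝ) = Fintype.card V - n' := by
    have h1 : Fintype.card ((↑U : Set V)ᶜ : Set V) + n' = Fintype.card V := by
      rw [← hU, ← Finset.card_compl_add_card U]
      congr 1
      rw [← Set.toFinset_card]
      congr 1
      ext x
      simp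
    rw [← h1]
    push_cast
    ring
  refine SimpleGraph.hasFracFactor_of_cut _ _ _ (fun _ => Nat.cast_le.2 hab) fun S T hST => ?_
  have key := SimpleGraph.cut_deleteEdges (G.induce (↑U : Set V)ᶜ) (a := a) (b := b) hab ha
    ?_ ?_ ?_ H hHm S T hST
  · simp only [Finset.sum_const, nsmul_eq_mul]
    rw [mul_comm, mul_comm (#S : ℤ)]
    convert key
  · intro x
    have h1 := SimpleGraph.degree_le_degree_induce_compl_add_card G U x
    have h2 := hmin x
    have h3 : (a : ℝ) ≤ b * ((b : ℝ) - Δ) / (a + Δ) := by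
      rw [le_div_iff₀ hα]
      nlinarith
    have h4 : a + m + n' ≤ G.degree x := by
      have : (a : ℝ) + m + n' ≤ G.degree x := by linarith
      exact_mod_cast this
    omega
  · have h1 : ((a : ℝ) + b) * (a + b + 2 * m - 2) / (a + Δ) <
        Fintype.card ((↑U : Set V)ᶜ : Set V) := by linarith
    rw [div_lt_iff₀ hα] at h1
    have h2 : ((a : ℝ) + b) * (a + b + 2 * m - 2) <
        b * Fintype.card ((↑U : Set V)ᶜ : Set V) := by
      have : (0 : ℝ) ≤ Fintype.card ((↑U : Set V)ᶜ : Set V) := by positivity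
      nlinarith
    exact_mod_cast h2
  · intro x y hxy hadj
    have h1 := hdeg x y (fun h => hxy (Subtype.ext h)) (by simpa using hadj)
    rw [ge_iff_le, div_le_iff₀ hc] at h1
    have hx : (G.degree x : ℝ) ≤ (G.induce (↑U : Set V)ᶜ).degree x + n' := by
      rw [← hU]
      exact_mod_cast SimpleGraph.degree_le_degree_induce_compl_add_card G U x
    have hy : (G.degree y : ℝ) ≤ (G.induce (↑U : Set V)ᶜ).degree y + n' := by
      rw [← hU]
      exact_mod_cast SimpleGraph.degree_le_degree_induce_compl_add_card G U y
    have h2 : 2 * (a : ℝ) * Fintype.card ((↑U : Set V)ᶜ : Set V) ≤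
        (a + b) * ((G.induce (↑U : Set V)ᶜ).degree x +
          (G.induce (↑U : Set V)ᶜ).degree y) := by
      have h3 : (0 : ℝ) ≤ Fintype.card ((↑U : Set V)ᶜ : Set V) := by positivity
      have h4 := mul_le_mul_of_nonneg_left (add_le_add hx hy) hc.le
      have h5 : (Fintype.card V : ℝ) = Fintype.card ((↑U : Set V)ᶜ : Set V) + n' := by linarith
      rw [h5] at h1
      nlinarith
    exact_mod_cast h2
end
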